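/- arXiv:2111.06470 — 5 statements merged into one kernel-verified Lean document; each statement's English description precedes it below -/
import Mathlib

section
/- Let q be a prime power, γ a primitive element of F_{q^2}, δ = γ^{q+1} (a primitive element of F_q), χ' and χ the canonical additive characters of F_{q^2} and F_q respectively. For integers e_1, e_2, e_3 with gcd(q+1, e_3) = 1, and for a, b ∈ F_q, c ∈ F_{q^2} with c ≠ 0, define S(a,b,c) = Σ_{x ∈ F_{q^2}^*} χ(a x^{(q+1)e_1} + b x^{(q+1)e_2}) χ'(c x^{e_3}). Then S(a,b,c) = -Σ_{z ∈ F_q^*} Σ_{x ∈ F_q^*} χ(z + a x^{e_1} + b x^{e_2} + z^{-1} c^{q+1} x^{e_3}). -/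
/-- The canonical additive character of a finite field of characteristic `p`. -/
noncomputable def canAddChar (p : ℕ) (F : Type) [Field F] [Fintype F]
    [Algebra (ZMod p) F] (x : F) : ℂ :=
  Complex.exp (2 * Real.pi * Complex.I * ((Algebra.trace (ZMod p) F x).val : ℂ) / p)

section QuadraticExtension

open Polynomial

variable {F E : Type*} [Field F] [Field E] [Algebra F E]

lemma exists_root_quadratic [Finite E] (h : Module.finrank F E = 2) (t m : F)
    (hr : ∀ z : F, z ^ 2 - t * z + m ≠ 0) :
    ∃ w : E, w ^ 2 - algebraMap F E t * w + algebraMap F E m = 0 := by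
  set f : F[X] := X ^ 2 - C t * X + C m with hf
  have hd : f.natDegree = 2 := by rw [hf]; compute_degree!
  have hirr : Irreducible f := by
    refine irreducible_of_degree_le_three_of_not_isRoot (by simp [hd]) fun z hz => hr z ?_
    simpa [hf, IsRoot.def] using hz
  have : Fact (Irreducible f) := ⟨hirr⟩
  have hfr : Module.finrank F (AdjoinRoot f) = 2 := by
    rw [(AdjoinRoot.powerBasis hirr.ne_zero).finrank, AdjoinRoot.powerBasis_dim, hd]
  obtain ⟨φ⟩ := FiniteField.nonempty_algHom_of_finrank_dvd
    (F := F) (K := AdjoinRoot f) (L := E) (by rw [hfr, h])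
  refine ⟨φ (AdjoinRoot.root f), ?_⟩
  have h0 : aeval (φ (AdjoinRoot.root f)) f = 0 := by
    rw [aeval_algHom_apply, AdjoinRoot.aeval_eq, AdjoinRoot.mk_self, map_zero]
  simpa [hf] using h0

variable [Fintype F]

lemma algebraMap_norm_of_finrank_eq_two [Finite E] (h : Module.finrank F E = 2) (w : E) :
    algebraMap F E (Algebra.norm F w) = w * w ^ Fintype.card F := by
  rw [FiniteField.algebraMap_norm_eq_prod_pow, h, Nat.card_eq_fintype_card]
  simp [Finset.prod_range_succ]

lemma algebraMap_trace_of_finrank_eq_two [Finite E] (h : Module.finrank F E = 2) (w : E) :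
    algebraMap F E (Algebra.trace F E w) = w + w ^ Fintype.card F := by
  rw [FiniteField.algebraMap_trace_eq_sum_pow, h, Nat.card_eq_fintype_card]
  simp [Finset.sum_range_succ]

lemma mem_range_of_pow_card_eq {w : E} (hw : w ^ Fintype.card F = w) :
    ∃ z : F, algebraMap F E z = w := by
  have hs := (FiniteField.X_pow_card_sub_X_natDegree_eq F (Fintype.one_lt_card (α := F)))
  have hp : (∏ a : F, (X - C a)) = (X ^ Fintype.card F - X : F[X]) := by
    have := Polynomial.prod_multiset_X_sub_C_of_monic_of_roots_card_eq
      (p := (X ^ Fintype.card F - X : F[X])) (by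
        apply monic_X_pow_sub
        rw [degree_X]; exact_mod_cast Fintype.one_lt_card (α := F)) (by
        rw [FiniteField.roots_X_pow_card_sub_X, hs]; simp)
    rw [FiniteField.roots_X_pow_card_sub_X] at this
    exact this
  have := congrArg (aeval w) hp
  simp [map_prod, hw, Finset.prod_eq_zero_iff, sub_eq_zero] at this
  exact this.imp fun _ h => h.symm

lemma card_norm_trace_eq_add_card_roots [Fintype E] [DecidableEq F] [DecidableEq E]
    (h : Module.finrank F E = 2) (t m : F) (hm : m ≠ 0) :
    (Finset.univ.filter fun w : E => Algebra.norm F w = m ∧ Algebra.trace F E w = t).card +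
      (Finset.univ.filter fun z : F => z ≠ 0 ∧ z + z⁻¹ * m = t).card = 2 := by
  have hinj := (algebraMap F E).injective
  have hA : ∀ w : E, (Algebra.norm F w = m ∧ Algebra.trace F E w = t) ↔
      w * w ^ Fintype.card F = algebraMap F E m ∧
        w + w ^ Fintype.card F = algebraMap F E t := fun w => by
    rw [← algebraMap_norm_of_finrank_eq_two h, ← algebraMap_trace_of_finrank_eq_two h,
      hinj.eq_iff, hinj.eq_iff]
  have hB : ∀ z : F, (z ≠ 0 ∧ z + z⁻¹ * m = t) ↔ z ^ 2 - t * z + m = 0 := fun z => by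
    constructor
    · rintro ⟨hz, rfl⟩
      field_simp
      ring
    · intro hz
      have hz0 : z ≠ 0 := by rintro rfl; simp at hz; exact hm hz
      refine ⟨hz0, ?_⟩
      field_simp
      linear_combination hz
  simp only [hA, hB]
  by_cases hr : ∃ z : F, z ^ 2 - t * z + m = 0
  · obtain ⟨z, hz⟩ := hr
    obtain ⟨s, rfl⟩ : ∃ s, t = z + s := ⟨t - z, by ring⟩
    obtain rfl : m = z * s := by linear_combination hz
    have hfix : ∀ z : F, algebraMap F E z ^ Fintype.card F = algebraMap F E z := fun z => by
      rw [← map_pow, FiniteField.pow_card]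
    have hBs : (Finset.univ.filter fun y : F => y ^ 2 - (z + s) * y + z * s = 0) = {z, s} := by
      ext y
      simp only [Finset.mem_filter_univ, Finset.mem_insert, Finset.mem_singleton]
      rw [show y ^ 2 - (z + s) * y + z * s = (y - z) * (y - s) by ring, mul_eq_zero, sub_eq_zero,
        sub_eq_zero]
    have hAw : ∀ w : E, w * w ^ Fintype.card F = algebraMap F E (z * s) →
        w + w ^ Fintype.card F = algebraMap F E (z + s) →
        (w = algebraMap F E z ∨ w = algebraMap F E s) ∧ z = s := by
      intro w h1 h2
      rw [map_mul] at h1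
      rw [map_add] at h2
      have h3 : (w - algebraMap F E z) * (w - algebraMap F E s) = 0 := by
        linear_combination w * h2 - h1
      rw [mul_eq_zero, sub_eq_zero, sub_eq_zero] at h3
      refine ⟨h3, hinj ?_⟩
      rcases h3 with rfl | rfl <;> rw [hfix] at h2
      · linear_combination h2
      · linear_combination -h2
    rw [hBs]
    by_cases hzs : z = s
    · subst hzs
      have : (Finset.univ.filter fun w : E => w * w ^ Fintype.card F = algebraMap F E (z * z) ∧
          w + w ^ Fintype.card F = algebraMap F E (z + z)) = {algebraMap F E z} := by
        ext w
        simp only [Finset.mem_filter_univ, Finset.mem_singleton]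
        constructor
        · rintro ⟨h1, h2⟩
          simpa using (hAw w h1 h2).1
        · rintro rfl
          simp [hfix]
      rw [this]
      simp
    · rw [Finset.card_pair hzs, Finset.filter_eq_empty_iff.2]
      · simp
      · rintro w - ⟨h1, h2⟩
        exact hzs (hAw w h1 h2).2
  · push Not at hr
    obtain ⟨w, hw⟩ := exists_root_quadratic (E := E) h t m hr
    have hne : w ≠ w ^ Fintype.card F := by
      intro he
      obtain ⟨z, rfl⟩ := mem_range_of_pow_card_eq he.symm
      refine hr z (hinj ?_)
      simpa using hw
    set v := w ^ Fintype.card F with hv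
    have hv' : v = FiniteField.frobeniusAlgHom F E w := rfl
    have hvr : v ^ 2 - algebraMap F E t * v + algebraMap F E m = 0 := by
      have := congrArg (FiniteField.frobeniusAlgHom F E) hw
      simpa only [map_add, map_sub, map_mul, map_pow, AlgHom.commutes, map_zero, ← hv'] using this
    have hsum : w + v = algebraMap F E t := by
      have : (w - v) * (w + v - algebraMap F E t) = 0 := by linear_combination hw - hvr
      rcases mul_eq_zero.1 this with h | h
      · exact absurd (sub_eq_zero.1 h) hne
      · exact sub_eq_zero.1 h
    have hprod : w * v = algebraMap F E m := by
      linear_combination w * hsum - hw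
    have hvv : v ^ Fintype.card F = w := by
      have : FiniteField.frobeniusAlgHom F E (w + v) = algebraMap F E t := by
        rw [hsum, AlgHom.commutes]
      rw [map_add, ← hv'] at this
      change v + v ^ Fintype.card F = _ at this
      linear_combination this - hsum
    have : (Finset.univ.filter fun x : E => x * x ^ Fintype.card F = algebraMap F E m ∧
          x + x ^ Fintype.card F = algebraMap F E t) = {w, v} := by
      ext x
      simp only [Finset.mem_filter_univ, Finset.mem_insert, Finset.mem_singleton]
      constructor
      · rintro ⟨h1, h2⟩
        have : (x - w) * (x - v) = 0 := by
          linear_combination x * h2 - h1 - x * hsum + hprod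
        simpa [sub_eq_zero] using this
      · rintro (rfl | rfl)
        · exact ⟨hprod, hsum⟩
        · rw [hvv, mul_comm, add_comm]; exact ⟨hprod, hsum⟩
    rw [this, Finset.card_pair hne, Finset.filter_eq_empty_iff.2 fun z _ => hr z,
      Finset.card_empty]

end QuadraticExtension

section Character

variable (p : ℕ) [Fact p.Prime] {F : Type} [Field F] [Fintype F] [Algebra (ZMod p) F]

lemma canAddChar_eq_stdAddChar (x : F) :
    canAddChar p F x = ZMod.stdAddChar (Algebra.trace (ZMod p) F x) := by
  rw [ZMod.stdAddChar_apply, ZMod.toCircle_apply, canAddChar]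

lemma canAddChar_add (x y : F) :
    canAddChar p F (x + y) = canAddChar p F x * canAddChar p F y := by
  simp only [canAddChar_eq_stdAddChar, map_add, AddChar.map_add_eq_mul]

lemma sum_canAddChar : ∑ x : F, canAddChar p F x = 0 := by
  let ψ : AddChar F ℂ :=
    ZMod.stdAddChar.compAddMonoidHom (Algebra.trace (ZMod p) F).toAddMonoidHom
  have hψ : ∀ x, canAddChar p F x = ψ x := canAddChar_eq_stdAddChar p
  simp only [hψ]
  refine AddChar.sum_eq_zero_of_ne_one fun h => ?_
  obtain ⟨x, hx⟩ := Algebra.trace_surjective (ZMod p) F 1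
  have h1 : ZMod.stdAddChar (Algebra.trace (ZMod p) F x) = (1 : ℂ) := DFunLike.congr_fun h x
  rw [hx, ← AddChar.map_zero_eq_one (ZMod.stdAddChar (N := p))] at h1
  exact one_ne_zero (ZMod.injective_stdAddChar h1)

variable {E : Type} [Field E] [Fintype E] [Algebra (ZMod p) E] [Algebra F E]

lemma canAddChar_trace (w : E) :
    canAddChar p F (Algebra.trace F E w) = canAddChar p E w := by
  have : IsScalarTower (ZMod p) F E := IsScalarTower.of_algebraMap_eq' (Subsingleton.elim _ _)
  rw [canAddChar_eq_stdAddChar, canAddChar_eq_stdAddChar, Algebra.trace_trace]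

/-- The sum of the canonical character over a norm fibre is minus a Kloosterman sum. -/
lemma sum_canAddChar_norm_eq [DecidableEq F] [DecidableEq E] (h : Module.finrank F E = 2)
    {m : F} (hm : m ≠ 0) :
    ∑ w : E with Algebra.norm F w = m, canAddChar p E w =
      -∑ z : F with z ≠ 0, canAddChar p F (z + z⁻¹ * m) := by
  have h1 : ∑ w : E with Algebra.norm F w = m, canAddChar p E w =
      ∑ t : F, ((Finset.univ.filter fun w : E =>
        Algebra.norm F w = m ∧ Algebra.trace F E w = t).card : ℂ) * canAddChar p F t := by
    rw [← Finset.sum_fiberwise _ (fun w => Algebra.trace F E w)]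
    refine Finset.sum_congr rfl fun t _ => ?_
    rw [Finset.filter_filter, ← nsmul_eq_mul]
    refine Finset.sum_eq_card_nsmul fun w hw => ?_
    rw [← (Finset.mem_filter_univ _).1 hw |>.2, canAddChar_trace]
  have h2 : ∑ z : F with z ≠ 0, canAddChar p F (z + z⁻¹ * m) =
      ∑ t : F, ((Finset.univ.filter fun z : F =>
        z ≠ 0 ∧ z + z⁻¹ * m = t).card : ℂ) * canAddChar p F t := by
    rw [← Finset.sum_fiberwise _ (fun z => z + z⁻¹ * m)]
    refine Finset.sum_congr rfl fun t _ => ?_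
    rw [Finset.filter_filter, ← nsmul_eq_mul]
    refine Finset.sum_eq_card_nsmul fun w hw => ?_
    rw [((Finset.mem_filter_univ _).1 hw).2]
  rw [eq_neg_iff_add_eq_zero, h1, h2, ← Finset.sum_add_distrib]
  simp only [← add_mul, ← Nat.cast_add, card_norm_trace_eq_add_card_roots h _ m hm,
    ← Finset.mul_sum, sum_canAddChar, mul_zero]

end Character

/-- If `gcd(q + 1, e) = 1`, then `x ↦ c * x ^ e` permutes norm fibres, so a sum over
`N(x) = y` can be reindexed as a sum over `N(w) = N(c) * y ^ e`. -/
lemma sum_norm_eq_mul_zpow {F E M : Type*} [Field F] [Fintype F] [DecidableEq F] [Field E]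
    [Fintype E] [Algebra F E] [AddCommMonoid M] (h : Module.finrank F E = 2) {e : ℤ}
    (he : Int.gcd (Fintype.card F + 1) e = 1) {c : E} (hc : c ≠ 0) {y : F} (hy : y ≠ 0)
    (f : E → M) :
    ∑ x : E with Algebra.norm F x = y, f (c * x ^ e) =
      ∑ w : E with Algebra.norm F w = Algebra.norm F c * y ^ e, f w := by
  set q := Fintype.card F with hq
  obtain ⟨s, t, hst⟩ : ∃ s t : ℤ, (q + 1) * s + e * t = 1 :=
    ⟨_, _, by rw [← Int.gcd_eq_gcd_ab, he, Nat.cast_one]⟩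
  have hnorm : ∀ x : E, algebraMap F E (Algebra.norm F x) = x ^ ((q : ℤ) + 1) := fun x => by
    rw [algebraMap_norm_of_finrank_eq_two h, ← hq, ← pow_succ', ← zpow_natCast, Nat.cast_succ]
  have hne : ∀ {x : E} {y : F}, y ≠ 0 → Algebra.norm F x = y → x ≠ 0 := by
    rintro x y hy rfl rfl
    exact hy (Algebra.norm_zero)
  have hy2 : y ^ ((q : ℤ) + 1) = y ^ 2 := by
    rw [zpow_add_one₀ hy, zpow_natCast, hq, FiniteField.pow_card, sq]
  let N : E →*₀ F := { Algebra.norm F with map_zero' := Algebra.norm_zero }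
  have hNz : ∀ (x : E) (n : ℤ), Algebra.norm F (x ^ n) = Algebra.norm F x ^ n := map_zpow₀ N
  have hNd : ∀ x : E, Algebra.norm F (x / c) = Algebra.norm F x / Algebra.norm F c :=
    fun x => map_div₀ N x c
  have hcN : Algebra.norm F c ≠ 0 := by simpa [Algebra.norm_eq_zero_iff] using hc
  refine Finset.sum_bij' (fun x _ => c * x ^ e)
    (fun w _ => algebraMap F E y ^ s * (w / c) ^ t) ?_ ?_ ?_ ?_ (fun _ _ => rfl)
  · intro x hx
    rw [Finset.mem_filter_univ] at hx ⊢
    rw [map_mul, hNz, hx]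
  · intro w hw
    rw [Finset.mem_filter_univ] at hw ⊢
    rw [map_mul, hNz, hNz, hNd, hw, Algebra.norm_algebraMap, h, ← hy2,
      mul_div_cancel_left₀ _ hcN, ← zpow_mul, ← zpow_mul, ← zpow_add₀ hy, hst, zpow_one]
  · intro x hx
    rw [Finset.mem_filter_univ] at hx
    have hx0 := hne hy hx
    rw [mul_div_cancel_left₀ _ hc, ← hx, hnorm, ← zpow_mul, ← zpow_mul, ← zpow_add₀ hx0, hst,
      zpow_one]
  · intro w hw
    rw [Finset.mem_filter_univ] at hw
    have hw0 : w ≠ 0 := hne (mul_ne_zero hcN (zpow_ne_zero e hy)) hw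
    have hwc : w / c ≠ 0 := div_ne_zero hw0 hc
    have hv : algebraMap F E y ^ e = (w / c) ^ ((q : ℤ) + 1) := by
      rw [← hnorm, hNd, hw, mul_div_cancel_left₀ _ hcN, map_zpow₀]
    rw [mul_zpow, ← zpow_mul, mul_comm s e, zpow_mul, hv, ← zpow_mul, ← zpow_mul,
      ← zpow_add₀ hwc, mul_comm t e, hst, zpow_one, mul_div_cancel₀ _ hc]

/-- Let `F = F_q`, `E = F_{q²}`, with canonical additive characters `χ` and `χ'`, and let
`N = Algebra.norm F : E → F` be the norm map (`N(x) = x^{q+1}`).  For integers `e₁,e₂,e₃`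
with `gcd(q+1, e₃) = 1` and `a, b ∈ F`, `c ∈ E` with `c ≠ 0`,
`S(a,b,c) = Σ_{x ∈ E^*} χ(a·N(x)^{e₁} + b·N(x)^{e₂})·χ'(c·x^{e₃})` equals
`-Σ_{z ∈ F^*} Σ_{x ∈ F^*} χ(z + a·x^{e₁} + b·x^{e₂} + z⁻¹·N(c)·x^{e₃})`. -/
theorem S_sum_eq (p q : ℕ) [Fact p.Prime] (F E : Type) [Field F] [Fintype F] [DecidableEq F]
    [Field E] [Fintype E] [DecidableEq E] [Algebra (ZMod p) F] [Algebra (ZMod p) E]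
    [Algebra F E] (hF : Fintype.card F = q) (hE : Fintype.card E = q ^ 2)
    (e₁ e₂ e₃ : ℤ) (he₃ : Int.gcd (q + 1) e₃ = 1)
    (a b : F) (c : E) (hc : c ≠ 0) :
    ∑ x ∈ Finset.univ.filter (fun x : E => x ≠ 0),
        canAddChar p F (a * (Algebra.norm F x) ^ e₁ + b * (Algebra.norm F x) ^ e₂) *
          canAddChar p E (c * x ^ e₃) =
      -∑ z ∈ Finset.univ.filter (fun z : F => z ≠ 0),
          ∑ x ∈ Finset.univ.filter (fun x : F => x ≠ 0),
            canAddChar p F (z + a * x ^ e₁ + b * x ^ e₂ +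
              z⁻¹ * (Algebra.norm F c) * x ^ e₃) := by
  subst hF
  have h : Module.finrank F E = 2 :=
    Nat.pow_right_injective (Fintype.one_lt_card (α := F))
      (Module.card_eq_pow_finrank.symm.trans hE)
  have hcN : Algebra.norm F c ≠ 0 := by simpa [Algebra.norm_eq_zero_iff] using hc
  rw [Finset.sum_comm, ← Finset.sum_neg_distrib,
    ← Finset.sum_fiberwise_of_maps_to (g := fun x => Algebra.norm F x)
      (t := Finset.univ.filter fun y : F => y ≠ 0)
      (by simp [Algebra.norm_eq_zero_iff])]
  refine Finset.sum_congr rfl fun y hy => ?_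
  rw [Finset.mem_filter_univ] at hy
  have hfib : ((Finset.univ.filter fun x : E => x ≠ 0).filter fun x => Algebra.norm F x = y) =
      Finset.univ.filter fun x : E => Algebra.norm F x = y := by
    rw [Finset.filter_filter]
    refine Finset.filter_congr fun x _ => and_iff_right_of_imp ?_
    rintro rfl rfl
    exact hy Algebra.norm_zero
  have hK := sum_canAddChar_norm_eq p (E := E) h (mul_ne_zero hcN (zpow_ne_zero e₃ hy))
  rw [← sum_norm_eq_mul_zpow h he₃ hc hy] at hK
  calc
    _ = ∑ x : E with Algebra.norm F x = y,
        canAddChar p F (a * y ^ e₁ + b * y ^ e₂) * canAddChar p E (c * x ^ e₃) := by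
      rw [hfib]
      refine Finset.sum_congr rfl fun x hx => ?_
      rw [(Finset.mem_filter_univ _).1 hx]
    _ = _ := by
      rw [← Finset.mul_sum, hK, mul_neg, Finset.mul_sum]
      congr 1
      refine Finset.sum_congr rfl fun z _ => ?_
      rw [← canAddChar_add]
      congr 1
      ring
end

section
/- Let q > 2 be a prime power, γ a primitive element of F_{q^2}, and e_1, e_2, e_3 integers with gcd(q+1, e_3) = 1, gcd(q-1, e_2-e_1) = 1, e_3 ≡ e_1 + e_2 (mod q-1). For a, b ∈ F_q and c ∈ F_{q^2}, let Z(a,b,c) = #{0 ≤ i < q^2-1 : a γ^{(q+1)i e_1} + b γ^{(q+1)i e_2} + Tr_{F_{q^2}/F_q}(c γ^{i e_3}) = 0}. Then Z takes the value q^2-1 exactly once (at a=b=c=0), the value 0 exactly 2(q-1) times, the value q+1 exactly (q-1)^2(q^2-q-1) times, the value q-1 exactly q^2-1 times, the value q exactly 2(q^2-1)(q-1) times, and the value 1 exactly (q^2-1)(q-1) times, as (a,b,c) ranges over F_q × F_q × F_{q^2}. -/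
/-- `Z(a,b,c)` counts `0 ≤ i < q²-1` with
`a·γ^{(q+1)ie₁} + b·γ^{(q+1)ie₂} + Tr_{E/F}(c·γ^{ie₃}) = 0`, where `E = F_{q²}`,
`F = F_q`, `γ` is a primitive element of `E`, and `Tr_{E/F}(x) = x + x^q`. -/
def Zval (q : ℕ) (F E : Type) [Field F] [Field E] [DecidableEq E] [Algebra F E]
    (γ : E) (e₁ e₂ e₃ : ℤ) (a b : F) (c : E) : ℕ :=
  ((Finset.range (q ^ 2 - 1)).filter (fun i : ℕ =>
    algebraMap F E a * γ ^ (((q : ℤ) + 1) * i * e₁) +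
      algebraMap F E b * γ ^ (((q : ℤ) + 1) * i * e₂) +
      (c * γ ^ ((i : ℤ) * e₃) + (c * γ ^ ((i : ℤ) * e₃)) ^ q) = 0)).card

open Finset

section FieldCounts

variable {F E : Type} [Field F] [Fintype F] [Field E] [Fintype E] [Algebra F E]

theorem finrank_eq_two_of_card {q : ℕ} (hF : Fintype.card F = q) (hE : Fintype.card E = q ^ 2) :
    Module.finrank F E = 2 := by
  have h := Module.card_eq_pow_finrank (K := F) (V := E)
  rw [hF, hE] at h
  exact (Nat.pow_right_injective (hF ▸ Fintype.one_lt_card) h).symm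

theorem algebraMap_norm_of_card {q : ℕ} (hF : Fintype.card F = q)
    (hE : Fintype.card E = q ^ 2) (x : E) :
    algebraMap F E (Algebra.norm F x) = x ^ (q + 1) := by
  rw [FiniteField.algebraMap_norm_eq_pow_sum, finrank_eq_two_of_card hF hE]
  simp [Finset.sum_range_succ, hF, add_comm]

theorem algebraMap_trace_of_card {q : ℕ} (hF : Fintype.card F = q)
    (hE : Fintype.card E = q ^ 2) (x : E) :
    algebraMap F E (Algebra.trace F E x) = x + x ^ q := by
  rw [FiniteField.algebraMap_trace_eq_sum_pow, finrank_eq_two_of_card hF hE]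
  simp [Finset.sum_range_succ, hF]

theorem card_trace_fiber [DecidableEq F] {q : ℕ} (hF : Fintype.card F = q)
    (hE : Fintype.card E = q ^ 2) (s : F) :
    #{y : E | Algebra.trace F E y = s} = q := by
  have hsurj := Algebra.trace_surjective F E
  have hconst (r : F) : #{y : E | Algebra.trace F E y = r} = #{y : E | Algebra.trace F E y = s} := by
    obtain ⟨z, hz⟩ := hsurj (s - r)
    refine Finset.card_equiv (Equiv.addRight z) fun y => ?_
    simp only [mem_filter, mem_univ, true_and, Equiv.coe_addRight, map_add, hz]
    rw [add_sub_left_comm, add_eq_left, sub_eq_zero]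
  have htotal := Finset.card_eq_sum_card_fiberwise (s := (univ : Finset E)) (t := (univ : Finset F))
    (f := Algebra.trace F E) (by simp)
  simp only [hconst, sum_const, card_univ, hF, hE, smul_eq_mul] at htotal
  have hq : 0 < q := hF ▸ Fintype.card_pos
  nlinarith

theorem card_norm_fiber [DecidableEq F] [DecidableEq E] {q : ℕ} (hF : Fintype.card F = q)
    (hE : Fintype.card E = q ^ 2) (s : F) :
    #{y : E | Algebra.norm F y = s} = if s = 0 then 1 else q + 1 := by
  have hzero : #{y : E | Algebra.norm F y = 0} = 1 := by
    simp [Algebra.norm_eq_zero_iff, Finset.filter_eq']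
  split_ifs with hs
  · rw [hs, hzero]
  have hconst (r : F) (hr : r ≠ 0) :
      #{y : E | Algebra.norm F y = r} = #{y : E | Algebra.norm F y = s} := by
    obtain ⟨z, hz⟩ := FiniteField.norm_surjective F E (s / r)
    have hz0 : z ≠ 0 := by
      rintro rfl
      exact div_ne_zero hs hr (by simpa using hz.symm)
    refine Finset.card_equiv (Equiv.mulRight₀ z hz0) fun y => ?_
    simp only [mem_filter, mem_univ, true_and, Equiv.mulRight₀_apply, map_mul, hz]
    rw [mul_div_left_comm, mul_eq_left₀ hs, div_eq_one_iff_eq hr]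
  have htotal := Finset.card_eq_sum_card_fiberwise (s := (univ : Finset E)) (t := (univ : Finset F))
    (f := Algebra.norm F) (by simp)
  rw [← Finset.add_sum_erase _ _ (mem_univ (0 : F)), hzero,
    Finset.sum_congr rfl fun r hr => hconst r (ne_of_mem_erase hr)] at htotal
  simp only [sum_const, card_erase_of_mem (mem_univ (0 : F)), card_univ, hF, hE, smul_eq_mul]
    at htotal
  have hq : 1 < q := hF ▸ Fintype.one_lt_card
  obtain ⟨k, rfl⟩ := Nat.exists_eq_add_of_lt hq
  simp only [Nat.add_sub_cancel] at htotal
  refine Nat.eq_of_mul_eq_mul_left (show 0 < 1 + k by omega) ?_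
  linarith

/-- Multiplying by `b` completes the norm. -/
theorem norm_complete {q : ℕ} (hF : Fintype.card F = q)
    (hE : Fintype.card E = q ^ 2) (a b : F) (hb : b ≠ 0) (c y : E) :
    a + b * Algebra.norm F y + Algebra.trace F E (c * y) = 0 ↔
      Algebra.norm F (algebraMap F E b * y + c ^ q) = Algebra.norm F c - a * b := by
  obtain ⟨p, hpF⟩ := CharP.exists F
  obtain ⟨n, hp, hn⟩ := FiniteField.card F p
  have : CharP E p := charP_of_injective_algebraMap (algebraMap F E).injective p
  have : ExpChar E p := .prime hp
  have hadd (u v : E) : (u + v) ^ q = u ^ q + v ^ q := by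
    rw [← hF, hn]; exact add_pow_expChar_pow u v p n
  have hbq : (algebraMap F E b) ^ q = algebraMap F E b := by
    rw [← map_pow, ← hF, FiniteField.pow_card]
  have hcq : (c ^ q) ^ q = c := by
    rw [← pow_mul, ← pow_two, ← hE, FiniteField.pow_card]
  have key : algebraMap F E (Algebra.norm F (algebraMap F E b * y + c ^ q)) =
      algebraMap F E (b * (a + b * Algebra.norm F y + Algebra.trace F E (c * y)) +
        (Algebra.norm F c - a * b)) := by
    simp only [map_add, map_mul, map_sub, algebraMap_norm_of_card hF hE,
      algebraMap_trace_of_card hF hE]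
    rw [pow_succ, hadd, mul_pow, mul_pow, hbq, hcq]
    ring
  rw [(algebraMap F E).injective key]
  simp [hb]

theorem card_nonzero_solutions [DecidableEq F] [DecidableEq E] {q : ℕ} (hF : Fintype.card F = q)
    (hE : Fintype.card E = q ^ 2) (a b : F) (c : E) :
    #{y : E | y ≠ 0 ∧ a + b * Algebra.norm F y + Algebra.trace F E (c * y) = 0} =
      if b = 0 then
        if a = 0 then if c = 0 then q ^ 2 - 1 else q - 1
        else if c = 0 then 0 else q
      else
        if a = 0 then if c = 0 then 0 else q
        else if Algebra.norm F c = a * b then 1 else q + 1 := by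
  have hall : #{y : E | a + b * Algebra.norm F y + Algebra.trace F E (c * y) = 0} =
      if b = 0 then
        if c = 0 then if a = 0 then q ^ 2 else 0 else q
      else if Algebra.norm F c = a * b then 1 else q + 1 := by
    split_ifs with hb hc ha hn
    · simp [ha, hb, hc, hE]
    · simp [ha, hb, hc]
    · rw [← card_trace_fiber hF hE (-a)]
      refine Finset.card_equiv (Equiv.mulLeft₀ c hc) fun y => ?_
      simp [hb, add_comm a, eq_neg_iff_add_eq_zero]
    all_goals
      have hb' : algebraMap F E b ≠ 0 := by simpa using hb
      have h := card_norm_fiber hF hE (Algebra.norm F c - a * b)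
      simp only [sub_eq_zero, hn, if_true, if_false] at h
      rw [← h]
      refine Finset.card_equiv ((Equiv.mulLeft₀ _ hb').trans (Equiv.addRight (c ^ q))) fun y => ?_
      simp [norm_complete hF hE a b hb, hn]
  have hset : ({y : E | y ≠ 0 ∧ a + b * Algebra.norm F y + Algebra.trace F E (c * y) = 0} :
      Finset E) =
      ({y : E | a + b * Algebra.norm F y + Algebra.trace F E (c * y) = 0} : Finset E).erase 0 := by
    ext; simp
  have hq : 0 < q := hF ▸ Fintype.card_pos
  rw [hset, card_erase_eq_ite, hall]
  by_cases ha : a = 0 <;> by_cases hb : b = 0 <;> by_cases hc : c = 0 <;>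
    simp [ha, hb, hc, Algebra.norm_eq_zero_iff]

theorem sum_ite_eq_zero {α : Type*} [Fintype α] [Zero α] [DecidableEq α] (X Y : ℕ) :
    ∑ a : α, (if a = 0 then X else Y) = X + (Fintype.card α - 1) * Y := by
  rw [← Finset.add_sum_erase _ _ (mem_univ (0 : α)), if_pos rfl,
    Finset.sum_congr rfl fun r hr => if_neg (ne_of_mem_erase hr)]
  simp

/-- The distribution of the number of nonzero solutions, tested against a function `f`. -/
theorem sum_card_nonzero_solutions [DecidableEq F] [DecidableEq E] {q : ℕ} (hF : Fintype.card F = q)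
    (hE : Fintype.card E = q ^ 2) (f : ℕ → ℕ) :
    ∑ t : F × F × E, f #{y : E | y ≠ 0 ∧
        t.1 + t.2.1 * Algebra.norm F y + Algebra.trace F E (t.2.2 * y) = 0} =
      f (q ^ 2 - 1) + 2 * (q - 1) * f 0 + (q - 1) ^ 2 * (q ^ 2 - q - 1) * f (q + 1) +
        (q ^ 2 - 1) * f (q - 1) + 2 * (q ^ 2 - 1) * (q - 1) * f q +
        (q ^ 2 - 1) * (q - 1) * f 1 := by
  have hnorm (s : F) (hs : s ≠ 0) :
      ∑ c : E, (if Algebra.norm F c = s then f 1 else f (q + 1)) =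
        (q + 1) * f 1 + (q ^ 2 - q - 1) * f (q + 1) := by
    have hcard := card_norm_fiber hF hE s
    rw [if_neg hs] at hcard
    have hcompl := Finset.card_filter_add_card_filter_not (s := (univ : Finset E))
      (fun c => Algebra.norm F c = s)
    rw [hcard, card_univ, hE] at hcompl
    rw [Finset.sum_ite, sum_const, sum_const, hcard, smul_eq_mul, smul_eq_mul]
    congr 2
    omega
  have hinner (a b : F) : ∑ c : E, f #{y : E | y ≠ 0 ∧
        a + b * Algebra.norm F y + Algebra.trace F E (c * y) = 0} =
      if a = 0 then
        if b = 0 then f (q ^ 2 - 1) + (q ^ 2 - 1) * f (q - 1) else f 0 + (q ^ 2 - 1) * f q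
      else
        if b = 0 then f 0 + (q ^ 2 - 1) * f q
        else (q + 1) * f 1 + (q ^ 2 - q - 1) * f (q + 1) := by
    simp only [card_nonzero_solutions hF hE]
    split_ifs with ha hb hb
    · simp only [apply_ite f, sum_ite_eq_zero, hE]
    · simp only [apply_ite f, sum_ite_eq_zero, hE]
    · simp only [apply_ite f, sum_ite_eq_zero, hE]
    · simp only [apply_ite f, hnorm _ (mul_ne_zero hb ha)]
  have hfactor : (q - 1) * (q + 1) = q ^ 2 - 1 := by
    rw [mul_comm, ← Nat.sq_sub_sq, one_pow]
  simp only [Fintype.sum_prod_type, hinner]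
  have hrow (a : F) : ∑ b : F, (if a = 0 then
        if b = 0 then f (q ^ 2 - 1) + (q ^ 2 - 1) * f (q - 1) else f 0 + (q ^ 2 - 1) * f q
      else
        if b = 0 then f 0 + (q ^ 2 - 1) * f q
        else (q + 1) * f 1 + (q ^ 2 - q - 1) * f (q + 1)) =
      if a = 0 then
        f (q ^ 2 - 1) + (q ^ 2 - 1) * f (q - 1) + (q - 1) * (f 0 + (q ^ 2 - 1) * f q)
      else f 0 + (q ^ 2 - 1) * f q +
        (q - 1) * ((q + 1) * f 1 + (q ^ 2 - q - 1) * f (q + 1)) := by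
    split_ifs <;> rw [sum_ite_eq_zero, hF]
  simp only [hrow, sum_ite_eq_zero, hF]
  simp only [← hfactor]
  ring

end FieldCounts

theorem Int.isCoprime_sq_sub_one {q e₁ e₂ e₃ : ℤ} (he₃ : IsCoprime (q + 1) e₃)
    (he₁₂ : IsCoprime (q - 1) (e₂ - e₁)) (hcong : q - 1 ∣ e₃ - (e₁ + e₂)) :
    IsCoprime (q ^ 2 - 1) (e₃ - (q + 1) * e₁) := by
  obtain ⟨k, hk⟩ := hcong
  rw [show q ^ 2 - 1 = (q + 1) * (q - 1) by ring]
  refine IsCoprime.mul_left ?_ ?_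
  · rw [show e₃ - (q + 1) * e₁ = e₃ + (q + 1) * (-e₁) by ring]
    exact he₃.add_mul_left_right _
  · rw [show e₃ - (q + 1) * e₁ = (e₂ - e₁) + (q - 1) * (k - e₁) by linear_combination hk]
    exact he₁₂.add_mul_left_right _

/-- The substitution `y = x ^ (e₃ - (q + 1) e₁)` with `x = γ ^ i` permutes the nonzero elements and
removes the exponents from the equation. -/
theorem Zval_eq_card_nonzero_solutions {F E : Type} [Field F] [Fintype F] [DecidableEq F] [Field E]
    [Fintype E] [DecidableEq E] [Algebra F E] {q : ℕ}
    (hF : Fintype.card F = q) (hE : Fintype.card E = q ^ 2)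
    (γ : E) (hγ : ∀ x : E, x ≠ 0 → ∃ n : ℕ, γ ^ n = x)
    (e₁ e₂ e₃ : ℤ) (he₃ : Int.gcd (q + 1) e₃ = 1)
    (he₁₂ : Int.gcd (q - 1) (e₂ - e₁) = 1) (hcong : ((q : ℤ) - 1) ∣ (e₃ - (e₁ + e₂)))
    (a b : F) (c : E) :
    Zval q F E γ e₁ e₂ e₃ a b c =
      #{y : E | y ≠ 0 ∧ a + b * Algebra.norm F y + Algebra.trace F E (c * y) = 0} := by
  have hq2 : 1 < q ^ 2 := hE ▸ Fintype.one_lt_card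
  have hcast : ((q ^ 2 - 1 : ℕ) : ℤ) = (q : ℤ) ^ 2 - 1 := by
    rw [Nat.cast_sub hq2.le]; simp
  have hγ0 : γ ≠ 0 := by
    rintro rfl
    have : Nontrivial Eˣ := by
      rw [← Fintype.one_lt_card_iff_nontrivial, Fintype.card_units, hE]
      have hq : 1 < q := hF ▸ Fintype.one_lt_card
      nlinarith [Nat.sub_add_cancel hq2.le]
    obtain ⟨u, hu⟩ := exists_ne (1 : Eˣ)
    obtain ⟨n, hn⟩ := hγ u u.ne_zero
    rcases Nat.eq_zero_or_pos n with rfl | hn0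
    · exact hu (Units.ext (by simpa using hn.symm))
    · exact u.ne_zero (by rw [← hn, zero_pow hn0.ne'])
  obtain ⟨u, rfl⟩ : ∃ u : Eˣ, (u : E) = γ := ⟨Units.mk0 γ hγ0, rfl⟩
  have horder : orderOf u = q ^ 2 - 1 := by
    rw [orderOf_eq_card_of_forall_mem_powers, Nat.card_eq_fintype_card, Fintype.card_units, hE]
    intro v
    obtain ⟨n, hn⟩ := hγ v v.ne_zero
    exact ⟨n, Units.ext (by simpa using hn)⟩
  have hmod (m n : ℤ) (h : (q : ℤ) ^ 2 - 1 ∣ n - m) : (u : E) ^ m = (u : E) ^ n := by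
    rw [← Units.val_zpow_eq_zpow_val, ← Units.val_zpow_eq_zpow_val,
      zpow_eq_zpow_iff_modEq.2 (Int.modEq_iff_dvd.2 (by rwa [horder, hcast]))]
  set d : ℤ := e₃ - (q + 1) * e₁ with hd
  have hcop : IsCoprime ((q : ℤ) ^ 2 - 1) d :=
    Int.isCoprime_sq_sub_one (Int.isCoprime_iff_gcd_eq_one.2 he₃)
      (Int.isCoprime_iff_gcd_eq_one.2 he₁₂) hcong
  have hinj : Set.InjOn (fun i : ℕ => (u : E) ^ ((i : ℤ) * d)) (range (q ^ 2 - 1)) := by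
    intro i hi j hj hij
    have hij' : u ^ ((i : ℤ) * d) = u ^ ((j : ℤ) * d) := Units.ext (by simpa using hij)
    rw [zpow_eq_zpow_iff_modEq, horder, Int.modEq_iff_dvd, hcast, ← sub_mul] at hij'
    have hdvd := hcop.dvd_of_dvd_mul_right hij'
    rw [← hcast, ← Int.modEq_iff_dvd, Int.natCast_modEq_iff] at hdvd
    exact hdvd.eq_of_lt_of_lt (by simpa using hi) (by simpa using hj)
  have himage : (range (q ^ 2 - 1)).image (fun i : ℕ => (u : E) ^ ((i : ℤ) * d)) =
      univ.erase 0 := by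
    refine Finset.eq_of_subset_of_card_le ?_ ?_
    · intro y hy
      obtain ⟨i, -, rfl⟩ := mem_image.1 hy
      simpa using zpow_ne_zero _ u.ne_zero
    · rw [card_image_of_injOn hinj, card_erase_of_mem (mem_univ _), card_univ, hE, card_range]
  have hset : ({y : E | y ≠ 0 ∧ a + b * Algebra.norm F y + Algebra.trace F E (c * y) = 0} :
      Finset E) = (univ.erase 0).filter
        fun y => a + b * Algebra.norm F y + Algebra.trace F E (c * y) = 0 := by
    ext; simp
  rw [hset, ← himage, filter_image,
    card_image_of_injOn (hinj.mono (coe_subset.2 (filter_subset _ _))), Zval]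
  congr 1
  refine filter_congr fun i _ => ?_
  set P : E := (u : E) ^ (((q : ℤ) + 1) * i * e₁) with hP
  set y : E := (u : E) ^ ((i : ℤ) * d) with hy
  have hP0 : P ≠ 0 := zpow_ne_zero _ u.ne_zero
  have hPq : P ^ q = P := by
    rw [hP, ← zpow_natCast, ← zpow_mul]
    exact hmod _ _ ⟨-(i * e₁), by ring⟩
  have hPy : P * y = (u : E) ^ ((i : ℤ) * e₃) := by
    rw [hP, hy, ← zpow_add₀ u.ne_zero, hd]
    congr 1
    ring
  have hPN : P * y ^ (q + 1) = (u : E) ^ (((q : ℤ) + 1) * i * e₂) := by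
    obtain ⟨k, hk⟩ := hcong
    rw [hP, hy, ← zpow_natCast, ← zpow_mul, ← zpow_add₀ u.ne_zero, hd]
    refine hmod _ _ ⟨i * (e₁ - k), ?_⟩
    push_cast
    linear_combination (-((q : ℤ) + 1) * i) * hk
  have hscale : algebraMap F E a * P + algebraMap F E b * (P * y ^ (q + 1)) +
      (c * (P * y) + (c * (P * y)) ^ q) =
      P * algebraMap F E (a + b * Algebra.norm F y + Algebra.trace F E (c * y)) := by
    simp only [map_add, map_mul, algebraMap_norm_of_card hF hE, algebraMap_trace_of_card hF hE,
      mul_pow, hPq]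
    ring
  rw [← hPy, ← hPN, hscale, mul_eq_zero, or_iff_right hP0, map_eq_zero]

/-- Value distribution of `Z(a,b,c)` as `(a,b,c)` ranges over `F_q × F_q × F_{q²}`:
value `q²-1` occurs once (at `a=b=c=0`), `0` occurs `2(q-1)` times, `q+1` occurs
`(q-1)²(q²-q-1)` times, `q-1` occurs `q²-1` times, `q` occurs `2(q²-1)(q-1)` times, and
`1` occurs `(q²-1)(q-1)` times. -/
theorem Zval_distribution (q : ℕ) (hq : 2 < q) (hppow : ∃ (p n : ℕ), p.Prime ∧ 0 < n ∧ q = p ^ n)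
    (F E : Type) [Field F] [Fintype F] [DecidableEq F] [Field E] [Fintype E] [DecidableEq E]
    [Algebra F E] (hF : Fintype.card F = q) (hE : Fintype.card E = q ^ 2)
    (γ : E) (hγ : ∀ x : E, x ≠ 0 → ∃ n : ℕ, γ ^ n = x)
    (e₁ e₂ e₃ : ℤ) (he₃ : Int.gcd (q + 1) e₃ = 1)
    (he₁₂ : Int.gcd (q - 1) (e₂ - e₁) = 1) (hcong : ((q : ℤ) - 1) ∣ (e₃ - (e₁ + e₂))) :
    Zval q F E γ e₁ e₂ e₃ 0 0 0 = q ^ 2 - 1 ∧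
    ((Finset.univ : Finset (F × F × E)).filter
      (fun t => Zval q F E γ e₁ e₂ e₃ t.1 t.2.1 t.2.2 = q ^ 2 - 1)).card = 1 ∧
    ((Finset.univ : Finset (F × F × E)).filter
      (fun t => Zval q F E γ e₁ e₂ e₃ t.1 t.2.1 t.2.2 = 0)).card = 2 * (q - 1) ∧
    ((Finset.univ : Finset (F × F × E)).filter
      (fun t => Zval q F E γ e₁ e₂ e₃ t.1 t.2.1 t.2.2 = q + 1)).card =
        (q - 1) ^ 2 * (q ^ 2 - q - 1) ∧
    ((Finset.univ : Finset (F × F × E)).filter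
      (fun t => Zval q F E γ e₁ e₂ e₃ t.1 t.2.1 t.2.2 = q - 1)).card = q ^ 2 - 1 ∧
    ((Finset.univ : Finset (F × F × E)).filter
      (fun t => Zval q F E γ e₁ e₂ e₃ t.1 t.2.1 t.2.2 = q)).card =
        2 * (q ^ 2 - 1) * (q - 1) ∧
    ((Finset.univ : Finset (F × F × E)).filter
      (fun t => Zval q F E γ e₁ e₂ e₃ t.1 t.2.1 t.2.2 = 1)).card =
        (q ^ 2 - 1) * (q - 1) := by
  have hZ (a b : F) (c : E) :=
    Zval_eq_card_nonzero_solutions hF hE γ hγ e₁ e₂ e₃ he₃ he₁₂ hcong a b c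
  have hcount (v : ℕ) := sum_card_nonzero_solutions hF hE fun n => if n = v then 1 else 0
  simp only [← Finset.card_filter] at hcount
  simp only [hZ, hcount]
  have hsq : 3 * q ≤ q ^ 2 := by nlinarith
  refine ⟨?_, ?_, ?_, ?_, ?_, ?_, ?_⟩
  · rw [card_nonzero_solutions hF hE]
    simp
  all_goals split_ifs <;> first | contradiction | omega
end

section
/- Under the hypotheses q > 2, gcd(q+1, e_3) = 1, gcd(q-1, e_2-e_1) = 1, e_3 ≡ e_1 + e_2 (mod q-1), the code C = { (a γ^{(q+1)i e_1} + b γ^{(q+1)i e_2} + Tr_{F_{q^2}/F_q}(c γ^{i e_3}))_{i=0}^{q^2-2} : a, b ∈ F_q, c ∈ F_{q^2} } has exactly five nonzero weights, with weight distribution: weight q(q-1)-2 occurring (q-1)^2(q^2-q-1) times, weight q(q-1)-1 occurring 2(q^2-1)(q-1) times, weight q(q-1) occurring q^2-1 times, weight q^2-2 occurring (q^2-1)(q-1) times, and weight q^2-1 occurring 2(q-1) times. -/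
/-- The codeword of `C_{((q+1)e₁,(q+1)e₂,e₃)}` associated with `(a,b,c) ∈ F_q × F_q × F_{q²}`:
`(a·γ^{(q+1)ie₁} + b·γ^{(q+1)ie₂} + Tr_{E/F}(c·γ^{ie₃}))_{i=0}^{q²-2}`, where
`Tr_{E/F}(x) = x + x^q`. -/
def codeword (q : ℕ) (F E : Type) [Field F] [Field E] [Algebra F E]
    (γ : E) (e₁ e₂ e₃ : ℤ) (a b : F) (c : E) : Fin (q ^ 2 - 1) → E := fun i =>
  algebraMap F E a * γ ^ (((q : ℤ) + 1) * i * e₁) +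
    algebraMap F E b * γ ^ (((q : ℤ) + 1) * i * e₂) +
    (c * γ ^ ((i : ℤ) * e₃) + (c * γ ^ ((i : ℤ) * e₃)) ^ q)

section

open Finset

@[to_additive]
theorem MonoidHom.card_fiber_of_surjective {G H : Type*} [Group G] [Fintype G] [Group H]
    [Fintype H] [DecidableEq H] (f : G →* H) (hf : Function.Surjective f) (h : H) :
    Fintype.card H * #{g | f g = h} = Fintype.card G := by
  have key := card_eq_sum_card_fiberwise (f := f) (s := univ) (t := univ) (by simp)
  rw [sum_congr rfl fun x _ ↦ MonoidHom.card_fiber_eq_of_mem_range f (hf x) (hf h)] at key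
  simpa using key.symm

namespace QuadraticFiniteField

theorem card_filter_prod {α β δ : Type*} [Fintype α] [Fintype β] [Fintype δ] (p : α → Prop)
    (r : β → Prop) (s : δ → Prop) [DecidablePred p] [DecidablePred r] [DecidablePred s] :
    #{t : α × β × δ | p t.1 ∧ r t.2.1 ∧ s t.2.2} =
      #{x : α | p x} * (#{y : β | r y} * #{z : δ | s z}) := by
  rw [← card_product, ← card_product]
  congr 1
  ext t
  simp

theorem card_filter_ne_zero {α : Type*} [Fintype α] [DecidableEq α] [Zero α] :
    #{x : α | x ≠ 0} = Fintype.card α - 1 := by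
  rw [filter_ne', card_erase_of_mem (mem_univ _), card_univ]

theorem card_filter_eq_zero {α : Type*} [Fintype α] [DecidableEq α] [Zero α] :
    #{x : α | x = 0} = 1 := by
  simp [filter_eq']

theorem card_exactly_one_ne_zero {α β : Type*} [Fintype α] [DecidableEq α] [Zero α]
    [Fintype β] [DecidableEq β] (s : β → Prop) [DecidablePred s] :
    #{t : α × α × β | (t.1 = 0 ∧ t.2.1 ≠ 0 ∧ s t.2.2) ∨ (t.1 ≠ 0 ∧ t.2.1 = 0 ∧ s t.2.2)} =
      2 * (#{z : β | s z} * (Fintype.card α - 1)) := by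
  rw [filter_or, card_union_of_disjoint, card_filter_prod (· = (0 : α)) (· ≠ (0 : α)),
    card_filter_prod (· ≠ (0 : α)) (· = (0 : α)), card_filter_ne_zero, card_filter_eq_zero]
  · ring
  · rw [disjoint_filter]
    tauto

theorem isCoprime_exponent {q e₁ e₂ e₃ : ℤ} (he₃ : IsCoprime (q + 1) e₃)
    (he₁₂ : IsCoprime (q - 1) (e₂ - e₁)) (hcong : q - 1 ∣ e₃ - (e₁ + e₂)) :
    IsCoprime (q ^ 2 - 1) (e₃ - (q + 1) * e₂) := by
  rw [show q ^ 2 - 1 = (q + 1) * (q - 1) by ring]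
  refine IsCoprime.mul_left ?_ ?_
  · rw [sub_eq_add_neg, ← mul_neg]
    exact he₃.add_mul_left_right _
  · obtain ⟨m, hm⟩ := hcong
    rw [show e₃ - (q + 1) * e₂ = -(e₂ - e₁) + (q - 1) * (m - e₂) by linear_combination hm]
    exact he₁₂.neg_right.add_mul_left_right _

theorem zpow_mul_injective {E : Type} [Field E] {q : ℕ} (hq : 0 < q) (u : Eˣ)
    (hu : orderOf u = q ^ 2 - 1) {k : ℤ}
    (hk : IsCoprime ((q : ℤ) ^ 2 - 1) k) :
    Function.Injective fun i : Fin (q ^ 2 - 1) ↦ (u : E) ^ ((i : ℤ) * k) := by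
  intro i j hij
  have hij' : u ^ ((i : ℤ) * k) = u ^ ((j : ℤ) * k) := Units.ext (by simpa using hij)
  have hcast : ((q ^ 2 - 1 : ℕ) : ℤ) = (q : ℤ) ^ 2 - 1 := by
    push_cast [Nat.one_le_pow 2 _ hq]
    rfl
  rw [zpow_eq_zpow_iff_modEq, Int.modEq_iff_dvd, hu, ← sub_mul, hcast] at hij'
  have hdvd := hk.dvd_of_dvd_mul_right hij'
  rw [← hcast, ← Int.modEq_iff_dvd, Int.natCast_modEq_iff] at hdvd
  exact Fin.ext (hdvd.eq_of_lt_of_lt i.isLt j.isLt)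

section

variable {E : Type} [Field E] [Fintype E]

theorem pow_card_pow_card {q : ℕ} (hE : Fintype.card E = q ^ 2) (x : E) :
    (x ^ q) ^ q = x := by
  rw [← pow_mul, ← sq, ← hE, FiniteField.pow_card]

theorem orderOf_eq_of_forall_pow {q : ℕ} (hE : Fintype.card E = q ^ 2) (u : Eˣ)
    (hu : ∀ x : E, x ≠ 0 → ∃ n : ℕ, (u : E) ^ n = x) : orderOf u = q ^ 2 - 1 := by
  classical
  rw [orderOf_eq_card_of_forall_mem_zpowers, Nat.card_eq_fintype_card, Fintype.card_units, hE]
  intro x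
  obtain ⟨n, hn⟩ := hu x x.ne_zero
  exact ⟨n, Units.ext (by simpa using hn)⟩

theorem zpow_card_sq_sub_one {q : ℕ} (hE : Fintype.card E = q ^ 2) {x : E} (hx : x ≠ 0) :
    x ^ ((q : ℤ) ^ 2 - 1) = 1 := by
  rw [zpow_sub_one₀ hx, ← Nat.cast_pow, zpow_natCast, ← hE, FiniteField.pow_card,
    mul_inv_cancel₀ hx]

end

variable {F E : Type} [Field F] [Fintype F] [Field E] [Fintype E] [Algebra F E]

theorem finrank_eq_two (hE : Fintype.card E = Fintype.card F ^ 2) : Module.finrank F E = 2 :=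
  Nat.pow_right_injective Fintype.one_lt_card
    ((Module.card_eq_pow_finrank (K := F) (V := E)).symm.trans hE)

theorem algebraMap_trace (hE : Fintype.card E = Fintype.card F ^ 2) (x : E) :
    algebraMap F E (Algebra.trace F E x) = x + x ^ Fintype.card F := by
  simp [FiniteField.algebraMap_trace_eq_sum_pow, finrank_eq_two hE, sum_range_succ]

theorem algebraMap_norm (hE : Fintype.card E = Fintype.card F ^ 2) (x : E) :
    algebraMap F E (Algebra.norm F x) = x * x ^ Fintype.card F := by
  simp [FiniteField.algebraMap_norm_eq_prod_pow, finrank_eq_two hE, prod_range_succ]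

theorem card_trace_fiber [DecidableEq F] (hE : Fintype.card E = Fintype.card F ^ 2) (t : F) :
    #{x : E | Algebra.trace F E x = t} = Fintype.card F := by
  have h := AddMonoidHom.card_fiber_of_surjective (Algebra.trace F E).toAddMonoidHom
    (Algebra.trace_surjective F E) t
  rw [hE, sq] at h
  exact Nat.eq_of_mul_eq_mul_left Fintype.card_pos h

theorem card_norm_fiber [DecidableEq F] (hE : Fintype.card E = Fintype.card F ^ 2) {d : F}
    (hd : d ≠ 0) : #{x : E | Algebra.norm F x = d} = Fintype.card F + 1 := by
  classical
  have h := MonoidHom.card_fiber_of_surjective (Units.map (Algebra.norm F (S := E)))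
    (FiniteField.unitsMap_norm_surjective F E) (Units.mk0 d hd)
  have hunits : #{u : Eˣ | Units.map (Algebra.norm F (S := E)) u = Units.mk0 d hd} =
      #{x : E | Algebra.norm F x = d} := by
    refine card_bij (fun u _ ↦ (u : E)) ?_ (fun _ _ _ _ ↦ Units.ext) ?_
    · intro u hu
      simpa [Units.ext_iff] using hu
    · intro x hx
      have hx0 : x ≠ 0 := by
        rintro rfl
        simp_all [eq_comm]
      exact ⟨Units.mk0 x hx0, by simpa [Units.ext_iff] using hx, rfl⟩
  rw [hunits, Fintype.card_units, Fintype.card_units, hE] at h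
  have h1 := Fintype.one_lt_card (α := F)
  refine Nat.eq_of_mul_eq_mul_left (Nat.sub_pos_of_lt h1) (h.trans ?_)
  obtain ⟨r, hr⟩ := Nat.exists_eq_add_of_lt h1
  rw [hr]
  zify [show 1 ≤ (1 + r + 1) ^ 2 from Nat.one_le_pow _ _ (by omega), show 1 ≤ 1 + r + 1 by omega]
  ring

/-- The Hermitian form `a N(z) + Tr(c z) + b` attached to the parameters of a codeword. -/
noncomputable def form (a b : F) (c z : E) : F :=
  a * Algebra.norm F z + Algebra.trace F E (c * z) + b

theorem mul_form (hE : Fintype.card E = Fintype.card F ^ 2) (a b : F) (c z : E) :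
    a * form a b c z =
      Algebra.norm F (algebraMap F E a * z + c ^ Fintype.card F) - (Algebra.norm F c - a * b) := by
  apply (algebraMap F E).injective
  have hadd := map_add (FiniteField.frobeniusAlgHom F E) (algebraMap F E a * z)
    (c ^ Fintype.card F)
  simp only [map_mul, FiniteField.coe_frobeniusAlgHom, pow_card_pow_card hE, AlgHom.commutes]
    at hadd
  simp only [form, map_mul, map_add, map_sub, algebraMap_norm hE, algebraMap_trace hE, hadd,
    mul_pow]
  ring

theorem card_form_zeros_of_ne_zero [DecidableEq F] (hE : Fintype.card E = Fintype.card F ^ 2)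
    {a : F} (ha : a ≠ 0) (b : F) (c : E) :
    #{z : E | form a b c z = 0} =
      if Algebra.norm F c = a * b then 1 else Fintype.card F + 1 := by
  classical
  have ha' : algebraMap F E a ≠ 0 := by simpa using ha
  have hcard : #{z : E | form a b c z = 0} =
      #{w : E | Algebra.norm F w = Algebra.norm F c - a * b} := by
    refine card_bijective (fun z ↦ algebraMap F E a * z + c ^ Fintype.card F)
      ((Equiv.addRight _).bijective.comp (mulLeft_bijective₀ _ ha')) fun z ↦ ?_
    rw [mem_filter_univ, mem_filter_univ, ← sub_eq_zero (b := _ - _), ← mul_form hE]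
    simp [ha]
  rw [hcard]
  split_ifs with h
  · have hzero : ({w : E | Algebra.norm F w = Algebra.norm F c - a * b} : Finset E) = {0} := by
      ext w
      simp [h, Algebra.norm_eq_zero_iff]
    rw [hzero, card_singleton]
  · exact card_norm_fiber hE (sub_ne_zero.mpr h)

theorem card_form_zeros_of_trace [DecidableEq F] (hE : Fintype.card E = Fintype.card F ^ 2)
    (b : F) {c : E} (hc : c ≠ 0) : #{z : E | form 0 b c z = 0} = Fintype.card F := by
  rw [← card_trace_fiber hE (-b)]
  refine card_bijective (c * ·) (mulLeft_bijective₀ c hc) fun z ↦ ?_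
  simp [form, eq_neg_iff_add_eq_zero]

theorem card_form_zeros_of_const [DecidableEq F] (hE : Fintype.card E = Fintype.card F ^ 2)
    (b : F) : #{z : E | form 0 b 0 z = 0} = if b = 0 then Fintype.card F ^ 2 else 0 := by
  split_ifs with h <;> simp [form, h, hE]

theorem codeword_apply (hE : Fintype.card E = Fintype.card F ^ 2) {γ : E} (hγ : γ ≠ 0)
    {e₁ e₂ e₃ : ℤ} (hcong : (Fintype.card F : ℤ) - 1 ∣ e₃ - (e₁ + e₂)) (a b : F) (c : E)
    (i : Fin (Fintype.card F ^ 2 - 1)) :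
    codeword (Fintype.card F) F E γ e₁ e₂ e₃ a b c i =
      γ ^ (((Fintype.card F : ℤ) + 1) * i * e₂) *
        algebraMap F E (form a b c (γ ^ ((i : ℤ) * (e₃ - ((Fintype.card F : ℤ) + 1) * e₂)))) := by
  set q : ℤ := (Fintype.card F : ℤ) with hq
  set x : E := γ ^ (i : ℤ) with hx
  have hx0 : x ≠ 0 := zpow_ne_zero _ hγ
  have hpow (y : E) : y ^ Fintype.card F = y ^ q := (zpow_natCast y _).symm
  have h1 : γ ^ ((q + 1) * i * e₁) = x ^ ((q + 1) * e₁) := by rw [hx, ← zpow_mul]; ring_nf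
  have h2 : γ ^ ((q + 1) * i * e₂) = x ^ ((q + 1) * e₂) := by rw [hx, ← zpow_mul]; ring_nf
  have h3 : γ ^ ((i : ℤ) * e₃) = x ^ e₃ := zpow_mul ..
  have h4 : γ ^ ((i : ℤ) * (e₃ - (q + 1) * e₂)) = x ^ (e₃ - (q + 1) * e₂) := zpow_mul ..
  clear_value x
  have hper (s t m : ℤ) (h : s = t + (q ^ 2 - 1) * m) : x ^ s = x ^ t := by
    rw [h, zpow_add₀ hx0, zpow_mul, zpow_card_sq_sub_one hE hx0, one_zpow, mul_one]
  obtain ⟨m, hm⟩ := hcong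
  have ha : x ^ ((q + 1) * e₂) * (x ^ (e₃ - (q + 1) * e₂) * (x ^ (e₃ - (q + 1) * e₂)) ^ q) =
      x ^ ((q + 1) * e₁) := by
    rw [← zpow_mul, ← zpow_add₀ hx0, ← zpow_add₀ hx0]
    exact hper _ _ (m - e₂) (by linear_combination (q + 1) * hm)
  have hc : x ^ ((q + 1) * e₂) * x ^ (e₃ - (q + 1) * e₂) = x ^ e₃ := by
    rw [← zpow_add₀ hx0]; ring_nf
  have hcq : x ^ ((q + 1) * e₂) * (x ^ (e₃ - (q + 1) * e₂)) ^ q = (x ^ e₃) ^ q := by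
    rw [← zpow_mul, ← zpow_mul, ← zpow_add₀ hx0]
    exact hper _ _ (-e₂) (by ring)
  simp only [codeword, form, ← hq, h1, h2, h3, h4, map_add, map_mul, algebraMap_norm hE,
    algebraMap_trace hE, hpow, mul_zpow]
  linear_combination -algebraMap F E a * ha - c * hc - c ^ q * hcq

theorem hammingNorm_codeword_add [DecidableEq F] [DecidableEq E]
    (hE : Fintype.card E = Fintype.card F ^ 2) (hq : 2 < Fintype.card F) {γ : E}
    (hγ : ∀ x : E, x ≠ 0 → ∃ n : ℕ, γ ^ n = x) {e₁ e₂ e₃ : ℤ}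
    (he₃ : IsCoprime ((Fintype.card F : ℤ) + 1) e₃)
    (he₁₂ : IsCoprime ((Fintype.card F : ℤ) - 1) (e₂ - e₁))
    (hcong : (Fintype.card F : ℤ) - 1 ∣ e₃ - (e₁ + e₂)) (a b : F) (c : E) :
    hammingNorm (codeword (Fintype.card F) F E γ e₁ e₂ e₃ a b c) + #{z : E | form a b c z = 0} =
      Fintype.card F ^ 2 - 1 + if b = 0 then 1 else 0 := by
  have hγ0 : γ ≠ 0 := by
    rintro rfl
    have hsub : (univ : Finset E) ⊆ {0, 1} := by
      intro x _
      by_cases hx : x = 0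
      · simp [hx]
      · obtain ⟨n, rfl⟩ := hγ x hx
        rcases n with _ | n <;> simp
    have h1 := (card_le_card hsub).trans card_le_two
    rw [card_univ, hE] at h1
    nlinarith
  have hf_inj := zpow_mul_injective Fintype.card_pos (Units.mk0 γ hγ0)
    (orderOf_eq_of_forall_pow hE (Units.mk0 γ hγ0) hγ) (isCoprime_exponent he₃ he₁₂ hcong)
  set f : Fin (Fintype.card F ^ 2 - 1) → E :=
    fun i ↦ γ ^ ((i : ℤ) * (e₃ - ((Fintype.card F : ℤ) + 1) * e₂)) with hf
  have hinj : Function.Injective f := hf_inj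
  have himage : univ.image f = univ.erase 0 := by
    refine eq_of_subset_of_card_le ?_ ?_
    · intro x hx
      obtain ⟨i, -, rfl⟩ := mem_image.mp hx
      simp [hf, zpow_ne_zero _ hγ0]
    · rw [card_image_of_injective _ hinj, card_erase_of_mem (mem_univ _), card_univ, hE]
      simp
  have hnorm : hammingNorm (codeword (Fintype.card F) F E γ e₁ e₂ e₃ a b c) =
      #{z ∈ univ.erase (0 : E) | ¬ form a b c z = 0} := by
    rw [← himage, filter_image, card_image_of_injective _ hinj, hammingNorm]
    congr 1
    ext i
    simp [codeword_apply hE hγ0 hcong, hf, zpow_ne_zero _ hγ0]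
  have hsplit := card_filter_add_card_filter_not (s := univ.erase (0 : E))
    (fun z ↦ form a b c z = 0)
  rw [← hnorm, card_erase_of_mem (mem_univ _), card_univ, hE, filter_erase] at hsplit
  have h0 : (0 : E) ∈ ({z : E | form a b c z = 0} : Finset E) ↔ b = 0 := by
    rw [mem_filter_univ]
    simp [form]
  split_ifs with hb
  · have hpos := card_pos.mpr ⟨_, h0.mpr hb⟩
    rw [card_erase_of_mem (h0.mpr hb)] at hsplit
    omega
  · rw [erase_eq_of_notMem (mt h0.mp hb)] at hsplit
    omega

theorem card_form_zeros [DecidableEq F] [DecidableEq E]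
    (hE : Fintype.card E = Fintype.card F ^ 2) (a b : F) (c : E) :
    #{z : E | form a b c z = 0} =
      if a = 0 then if c = 0 then if b = 0 then Fintype.card F ^ 2 else 0 else Fintype.card F
      else if Algebra.norm F c = a * b then 1 else Fintype.card F + 1 := by
  by_cases ha : a = 0
  · subst ha
    by_cases hc : c = 0
    · simp [hc, card_form_zeros_of_const hE]
    · simp [hc, card_form_zeros_of_trace hE]
  · simp [ha, card_form_zeros_of_ne_zero hE]

theorem card_norm_eq_mul [DecidableEq F] [DecidableEq E]
    (hE : Fintype.card E = Fintype.card F ^ 2) :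
    #{t : F × F × E | t.1 ≠ 0 ∧ t.2.1 ≠ 0 ∧ Algebra.norm F t.2.2 = t.1 * t.2.1} =
      (Fintype.card F ^ 2 - 1) * (Fintype.card F - 1) := by
  rw [← hE, ← card_filter_ne_zero (α := E), ← card_filter_ne_zero (α := F), ← card_product]
  refine card_bij' (fun t _ ↦ (t.2.2, t.1)) (fun s _ ↦ (s.2, s.2⁻¹ * Algebra.norm F s.1, s.1))
    ?_ ?_ ?_ ?_
  · rintro ⟨a, b, c⟩ h
    rw [mem_filter_univ] at h
    have hc : c ≠ 0 := by
      rintro rfl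
      simp_all only [ne_eq, Algebra.norm_zero, zero_eq_mul]
      tauto
    simp [h.1, hc]
  · rintro ⟨c, a⟩ h
    have h' : c ≠ 0 ∧ a ≠ 0 := by simpa using h
    rw [mem_filter_univ]
    simp [h'.1, h'.2, Algebra.norm_eq_zero_iff]
  · rintro ⟨a, b, c⟩ h
    rw [mem_filter_univ] at h
    simp [h.2.2, h.1]
  · simp

theorem card_norm_ne_mul [DecidableEq F] [DecidableEq E]
    (hE : Fintype.card E = Fintype.card F ^ 2) :
    #{t : F × F × E | t.1 ≠ 0 ∧ t.2.1 ≠ 0 ∧ Algebra.norm F t.2.2 ≠ t.1 * t.2.1} =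
      (Fintype.card F - 1) ^ 2 * (Fintype.card F ^ 2 - Fintype.card F - 1) := by
  have hsplit := card_filter_add_card_filter_not
    (s := ({t : F × F × E | t.1 ≠ 0 ∧ t.2.1 ≠ 0 ∧ True} : Finset _))
    (fun t ↦ Algebra.norm F t.2.2 = t.1 * t.2.1)
  rw [card_filter_prod (· ≠ (0 : F)) (· ≠ (0 : F)) (fun _ : E ↦ True), card_filter_ne_zero,
    filter_filter, filter_filter] at hsplit
  simp only [and_true, and_assoc, filter_true, card_univ, hE, card_norm_eq_mul hE] at hsplit
  obtain ⟨r, hr⟩ := Nat.exists_eq_add_of_lt (Fintype.one_lt_card (α := F))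
  simp only [hr] at hsplit ⊢
  rw [show 1 + r + 1 - 1 = r + 1 by omega,
    show (1 + r + 1) ^ 2 - 1 = (r + 1) * (r + 3) by rw [Nat.sub_eq_iff_eq_add (by nlinarith)]; ring]
    at hsplit
  rw [show 1 + r + 1 - 1 = r + 1 by omega,
    show (1 + r + 1) ^ 2 - (1 + r + 1) - 1 = r ^ 2 + 3 * r + 1 by
      rw [Nat.sub_sub, Nat.sub_eq_iff_eq_add (by nlinarith)]; ring]
  linarith

end QuadraticFiniteField

end

/-- Weight distribution of the five-weight code: as `(a,b,c)` ranges over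
`F_q × F_q × F_{q²}`, the Hamming weight `q(q-1)-2` occurs `(q-1)²(q²-q-1)` times,
`q(q-1)-1` occurs `2(q²-1)(q-1)` times, `q(q-1)` occurs `q²-1` times, `q²-2` occurs
`(q²-1)(q-1)` times, and `q²-1` occurs `2(q-1)` times; these are the only nonzero
weights (weight `0` occurs once). -/
theorem code_weight_distribution (q : ℕ) (hq : 2 < q)
    (hppow : ∃ (p n : ℕ), p.Prime ∧ 0 < n ∧ q = p ^ n)
    (F E : Type) [Field F] [Fintype F] [DecidableEq F] [Field E] [Fintype E] [DecidableEq E]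
    [Algebra F E] (hF : Fintype.card F = q) (hE : Fintype.card E = q ^ 2)
    (γ : E) (hγ : ∀ x : E, x ≠ 0 → ∃ n : ℕ, γ ^ n = x)
    (e₁ e₂ e₃ : ℤ) (he₃ : Int.gcd (q + 1) e₃ = 1)
    (he₁₂ : Int.gcd (q - 1) (e₂ - e₁) = 1) (hcong : ((q : ℤ) - 1) ∣ (e₃ - (e₁ + e₂))) :
    ((Finset.univ : Finset (F × F × E)).filter
      (fun t => hammingNorm (codeword q F E γ e₁ e₂ e₃ t.1 t.2.1 t.2.2) = 0)).card = 1 ∧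
    ((Finset.univ : Finset (F × F × E)).filter
      (fun t => hammingNorm (codeword q F E γ e₁ e₂ e₃ t.1 t.2.1 t.2.2) =
        q * (q - 1) - 2)).card = (q - 1) ^ 2 * (q ^ 2 - q - 1) ∧
    ((Finset.univ : Finset (F × F × E)).filter
      (fun t => hammingNorm (codeword q F E γ e₁ e₂ e₃ t.1 t.2.1 t.2.2) =
        q * (q - 1) - 1)).card = 2 * (q ^ 2 - 1) * (q - 1) ∧
    ((Finset.univ : Finset (F × F × E)).filter
      (fun t => hammingNorm (codeword q F E γ e₁ e₂ e₃ t.1 t.2.1 t.2.2) =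
        q * (q - 1))).card = q ^ 2 - 1 ∧
    ((Finset.univ : Finset (F × F × E)).filter
      (fun t => hammingNorm (codeword q F E γ e₁ e₂ e₃ t.1 t.2.1 t.2.2) =
        q ^ 2 - 2)).card = (q ^ 2 - 1) * (q - 1) ∧
    ((Finset.univ : Finset (F × F × E)).filter
      (fun t => hammingNorm (codeword q F E γ e₁ e₂ e₃ t.1 t.2.1 t.2.2) =
        q ^ 2 - 1)).card = 2 * (q - 1) := by
  subst hF
  have h3 : 3 * Fintype.card F ≤ Fintype.card F ^ 2 := by nlinarith
  have hmul : Fintype.card F * (Fintype.card F - 1) = Fintype.card F ^ 2 - Fintype.card F := by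
    rw [Nat.mul_sub, mul_one, sq]
  have hweight (t : F × F × E) := QuadraticFiniteField.hammingNorm_codeword_add hE hq hγ
    (Int.isCoprime_iff_gcd_eq_one.mpr he₃) (Int.isCoprime_iff_gcd_eq_one.mpr he₁₂) hcong
    t.1 t.2.1 t.2.2
  simp only [QuadraticFiniteField.card_form_zeros hE] at hweight
  have hnorm (c : E) : Algebra.norm F c = 0 ↔ c = 0 := Algebra.norm_eq_zero_iff
  have hcount (w : ℕ) (P : F × F × E → Prop) [DecidablePred P]
      (hP : ∀ t, hammingNorm (codeword (Fintype.card F) F E γ e₁ e₂ e₃ t.1 t.2.1 t.2.2) = w ↔ P t) :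
      (Finset.univ.filter fun t : F × F × E ↦
        hammingNorm (codeword (Fintype.card F) F E γ e₁ e₂ e₃ t.1 t.2.1 t.2.2) = w).card =
      (Finset.univ.filter P).card :=
    congrArg Finset.card (Finset.filter_congr fun t _ ↦ hP t)
  rw [hmul]
  refine ⟨?_, ?_, ?_, ?_, ?_, ?_⟩
  · rw [hcount _ (fun t ↦ t.1 = 0 ∧ t.2.1 = 0 ∧ t.2.2 = 0),
      QuadraticFiniteField.card_filter_prod (· = (0 : F)) (· = (0 : F)) (· = (0 : E))]
    · simp only [QuadraticFiniteField.card_filter_eq_zero, mul_one]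
    · rintro ⟨a, b, c⟩
      have h := hweight (a, b, c)
      have hc := hnorm c
      grind
  · rw [hcount _ (fun t ↦ t.1 ≠ 0 ∧ t.2.1 ≠ 0 ∧ Algebra.norm F t.2.2 ≠ t.1 * t.2.1),
      QuadraticFiniteField.card_norm_ne_mul hE]
    rintro ⟨a, b, c⟩
    have h := hweight (a, b, c)
    have hc := hnorm c
    grind
  · rw [hcount _ (fun t ↦ (t.1 = 0 ∧ t.2.1 ≠ 0 ∧ t.2.2 ≠ 0) ∨ (t.1 ≠ 0 ∧ t.2.1 = 0 ∧ t.2.2 ≠ 0)),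
      QuadraticFiniteField.card_exactly_one_ne_zero (· ≠ (0 : E)),
      QuadraticFiniteField.card_filter_ne_zero, hE, mul_assoc]
    rintro ⟨a, b, c⟩
    have h := hweight (a, b, c)
    have hc := hnorm c
    grind
  · rw [hcount _ (fun t ↦ t.1 = 0 ∧ t.2.1 = 0 ∧ t.2.2 ≠ 0),
      QuadraticFiniteField.card_filter_prod (· = (0 : F)) (· = (0 : F)) (· ≠ (0 : E))]
    · simp only [QuadraticFiniteField.card_filter_eq_zero,
        QuadraticFiniteField.card_filter_ne_zero, one_mul, hE]
    · rintro ⟨a, b, c⟩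
      have h := hweight (a, b, c)
      have hc := hnorm c
      grind
  · rw [hcount _ (fun t ↦ t.1 ≠ 0 ∧ t.2.1 ≠ 0 ∧ Algebra.norm F t.2.2 = t.1 * t.2.1),
      QuadraticFiniteField.card_norm_eq_mul hE]
    rintro ⟨a, b, c⟩
    have h := hweight (a, b, c)
    have hc := hnorm c
    grind
  · rw [hcount _ (fun t ↦ (t.1 = 0 ∧ t.2.1 ≠ 0 ∧ t.2.2 = 0) ∨ (t.1 ≠ 0 ∧ t.2.1 = 0 ∧ t.2.2 = 0)),
      QuadraticFiniteField.card_exactly_one_ne_zero (· = (0 : E)),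
      QuadraticFiniteField.card_filter_eq_zero, one_mul]
    rintro ⟨a, b, c⟩
    have h := hweight (a, b, c)
    have hc := hnorm c
    grind
end

section
/- Let q > 2 be a prime power. The number of distinct cyclic codes of the form C_{((q+1)e_1, (q+1)e_2, e_3)} satisfying gcd(q+1, e_3) = 1, gcd(q-1, e_2-e_1) = 1, and e_3 ≡ e_1 + e_2 (mod q-1) is (q-1)·φ(q^2-1)/4, where φ is the Euler totient function. -/
open Polynomial

section GroupLemmas

variable {G : Type*} [CommGroup G]

lemma orderOf_zpow_eq_orderOf_iff [Finite G] (g : G) (k : ℤ) :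
    orderOf (g ^ k) = orderOf g ↔ IsCoprime k (orderOf g : ℤ) := by
  rw [Int.isCoprime_iff_gcd_eq_one, ← mem_zpowers_zpow_iff]
  have hle : Subgroup.zpowers (g ^ k) ≤ Subgroup.zpowers g := by
    rw [Subgroup.zpowers_le]
    exact ⟨k, rfl⟩
  constructor
  · intro h
    have := Subgroup.eq_of_le_of_card_ge hle (by rw [Nat.card_zpowers, Nat.card_zpowers, h])
    rw [this]
    exact Subgroup.mem_zpowers g
  · intro h
    exact Nat.dvd_antisymm (orderOf_dvd_of_mem_zpowers ⟨k, rfl⟩) (orderOf_dvd_of_mem_zpowers h)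

lemma IsCyclic.card_filter_pow_eq_one [Fintype G] [DecidableEq G] [IsCyclic G] (d : ℕ) :
    (Finset.univ.filter fun a : G => a ^ d = 1).card = (Nat.card G).gcd d := by
  rw [← IsCyclic.card_powMonoidHom_ker, ← Fintype.card_subtype, ← Nat.card_eq_fintype_card]
  rfl

lemma pow_eq_self_of_pow_pred_eq_one {q : ℕ} (hq : 2 < q) {a : G} (ha : a ^ (q - 1) = 1) :
    a ^ q = a := by
  obtain ⟨n, rfl⟩ : ∃ n, q = n + 1 := ⟨q - 1, by omega⟩
  rw [pow_succ, show a ^ n = 1 from ha, one_mul]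

variable {q : ℕ} {a w : G}

lemma pow_ne_one_of_orderOf_eq (hq : 2 < q) (hw : orderOf w = q ^ 2 - 1) {m : ℕ} (hm : 0 < m)
    (hmq : m ≤ q + 1) : w ^ m ≠ 1 := by
  intro h
  have h1 := Nat.le_of_dvd hm (orderOf_dvd_of_pow_eq_one h)
  have h2 : q + 1 < q ^ 2 - 1 := by
    have : q ^ 2 ≥ 3 * q := by nlinarith
    omega
  omega

lemma pow_pow_eq_self_of_orderOf_eq (hq : 2 < q) (hw : orderOf w = q ^ 2 - 1) :
    (w ^ q) ^ q = w := by
  have h : w ^ (q ^ 2 - 1 + 1) = w := by rw [pow_succ, ← hw, pow_orderOf_eq_one, one_mul]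
  rw [← pow_mul, ← sq]
  rwa [Nat.sub_add_cancel (by nlinarith)] at h

lemma mul_pow_ne_self (hq : 2 < q) (ha : a ^ q = a) (hw : orderOf w = q ^ 2 - 1) :
    (a * w) ^ q ≠ a * w := by
  intro h
  rw [mul_pow, ha, mul_right_inj] at h
  refine pow_ne_one_of_orderOf_eq hq hw (m := q - 1) (by omega) (by omega) ?_
  rw [← mul_right_inj w, ← pow_succ', Nat.sub_add_cancel (by omega), h, mul_one]

lemma orderOf_pow_self_eq (hq : 2 < q) (hw : orderOf w = q ^ 2 - 1) :
    orderOf (w ^ q) = q ^ 2 - 1 := by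
  rw [Nat.Coprime.orderOf_pow, hw]
  rw [hw]
  have : (q ^ 2 - 1).Coprime (q ^ 2) := by
    rw [Nat.coprime_self_sub_left (by nlinarith)]
    exact Nat.coprime_one_left _
  exact Nat.Coprime.coprime_dvd_right (dvd_pow_self q two_ne_zero) this

end GroupLemmas

section Fields

variable (F : Type*) {E : Type*} [Field F] [Field E] [Algebra F E]

/-- The parity-check polynomial attached to `a = γ ^ (-(q+1)e₁)` and `w`, where
`a * w = γ ^ (-e₃)` and `a * w ^ (q + 1) = γ ^ (-(q+1)e₂)`. -/
noncomputable def parityPoly (q : ℕ) (p : Eˣ × Eˣ) : F[X] :=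
  minpoly F (p.1 : E) * minpoly F ((p.1 * p.2 ^ (q + 1) : Eˣ) : E) *
    minpoly F ((p.1 * p.2 : Eˣ) : E)

variable {F} [Fintype F] [Fintype E]

lemma minpoly_pow_card (x : E) : minpoly F (x ^ Fintype.card F) = minpoly F x :=
  minpoly.algEquiv_eq (FiniteField.frobeniusAlgEquivOfAlgebraic F E) x

lemma aeval_minpoly_eq_zero_iff_of_card_sq (hE : Fintype.card E = Fintype.card F ^ 2) (x y : E) :
    aeval y (minpoly F x) = 0 ↔ y = x ∨ y = x ^ Fintype.card F := by
  have hfin : Module.finrank F E = 2 := by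
    have h := Module.card_eq_pow_finrank (K := F) (V := E)
    rw [hE] at h
    exact (Nat.pow_right_injective Fintype.one_lt_card h).symm
  constructor
  · intro h
    obtain ⟨σ, hσ⟩ := ((isConjRoot_iff_aeval_eq_zero (Algebra.IsIntegral.isIntegral x)).2 h).symm
      |>.exists_algEquiv
    obtain ⟨⟨i, hi⟩, rfl⟩ := (FiniteField.bijective_frobeniusAlgEquivOfAlgebraic_pow F E).2 σ
    rw [hfin] at hi
    interval_cases i
    · left; simpa using hσ.symm
    · right; simpa using hσ.symm
  · rintro (rfl | rfl)
    · exact minpoly.aeval F _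
    · rw [← minpoly_pow_card]
      exact minpoly.aeval F _

variable {q : ℕ}

lemma aeval_parityPoly_eq_zero_iff (hF : Fintype.card F = q) (hE : Fintype.card E = q ^ 2)
    {a w : Eˣ} (ha : a ^ q = a) (hw : (w ^ q) ^ q = w) (y : Eˣ) :
    aeval (y : E) (parityPoly F q (a, w)) = 0 ↔
      y = a ∨ y = a * w ^ (q + 1) ∨ y = a * w ∨ y = a * w ^ q := by
  subst hF
  have hN : (a * w ^ (Fintype.card F + 1)) ^ Fintype.card F = a * w ^ (Fintype.card F + 1) := by
    rw [mul_pow, ha, pow_succ, mul_pow, hw, mul_comm w]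
  have hW : (a * w) ^ Fintype.card F = a * w ^ Fintype.card F := by rw [mul_pow, ha]
  simp only [parityPoly, map_mul, mul_eq_zero, aeval_minpoly_eq_zero_iff_of_card_sq hE,
    ← Units.val_pow_eq_pow_val, Units.val_inj, ha, hN, hW]
  tauto

lemma parityPoly_eq_iff (hq : 2 < q) (hF : Fintype.card F = q) (hE : Fintype.card E = q ^ 2)
    {a w a' w' : Eˣ} (ha : a ^ q = a) (hw : orderOf w = q ^ 2 - 1)
    (ha' : a' ^ q = a') (hw' : orderOf w' = q ^ 2 - 1) :
    parityPoly F q (a', w') = parityPoly F q (a, w) ↔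
      (a', w') = (a, w) ∨ (a', w') = (a, w ^ q) ∨ (a', w') = (a * w ^ (q + 1), w⁻¹) ∨
        (a', w') = (a * w ^ (q + 1), (w ^ q)⁻¹) := by
  have hww := pow_pow_eq_self_of_orderOf_eq hq hw
  have hww' := pow_pow_eq_self_of_orderOf_eq hq hw'
  have hWq : minpoly F ((a * w ^ q : Eˣ) : E) = minpoly F ((a * w : Eˣ) : E) := by
    rw [← minpoly_pow_card ((a * w : Eˣ) : E), hF, ← Units.val_pow_eq_pow_val, mul_pow, ha]
  constructor
  · intro h
    have key := aeval_parityPoly_eq_zero_iff hF hE ha hww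
    have key' := aeval_parityPoly_eq_zero_iff hF hE ha' hww'
    rw [h] at key'
    have hN : (a * w ^ (q + 1)) ^ q = a * w ^ (q + 1) := by
      rw [mul_pow, ha, pow_succ, mul_pow, hww, mul_comm w]
    have hnot := mul_pow_ne_self hq ha hw
    have hnot' := mul_pow_ne_self hq ha' hw'
    have h1 : a' = a ∨ a' = a * w ^ (q + 1) := by
      rcases (key a').1 ((key' a').2 (by simp)) with h | h | h | h
      · exact .inl h
      · exact .inr h
      · exact absurd (h ▸ ha') hnot
      · refine absurd ?_ hnot
        have h2 : a' = a * w := by rw [← ha', h, mul_pow, ha, hww]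
        exact h2 ▸ ha'
    have h2 : a' * w' = a * w ∨ a' * w' = a * w ^ q := by
      rcases (key (a' * w')).1 ((key' (a' * w')).2 (by simp)) with h | h | h | h
      · exact absurd (h ▸ ha) hnot'
      · exact absurd (h ▸ hN) hnot'
      · exact .inl h
      · exact .inr h
    rcases h1 with rfl | rfl <;> rcases h2 with h2 | h2
    · simp [mul_left_cancel h2]
    · simp [mul_left_cancel h2]
    · rw [mul_assoc, mul_right_inj] at h2
      have : w' = (w ^ q)⁻¹ := by
        rw [eq_inv_iff_mul_eq_one]
        rw [pow_succ] at h2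
        apply mul_left_cancel (a := w)
        rw [mul_one]
        refine Eq.trans ?_ h2
        ac_rfl
      simp [this]
    · rw [mul_assoc, mul_right_inj] at h2
      have : w' = w⁻¹ := by
        rw [eq_inv_iff_mul_eq_one]
        rw [pow_succ] at h2
        apply mul_left_cancel (a := w ^ q)
        rw [mul_one]
        refine Eq.trans ?_ h2
        ac_rfl
      simp [this]
  · have e1 : a * w ^ (q + 1) * w⁻¹ = a * w ^ q := by rw [pow_succ]; group
    have e2 : a * w ^ (q + 1) * (w ^ q)⁻¹ = a * w := by
      rw [pow_succ', mul_assoc, mul_inv_cancel_right]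
    have e3 : a * w ^ (q + 1) * (w⁻¹) ^ (q + 1) = a := by
      rw [inv_pow, mul_inv_cancel_right]
    have e4 : (w ^ q) ^ (q + 1) = w ^ (q + 1) := by rw [pow_succ, hww, pow_succ']
    have e5 : a * w ^ (q + 1) * ((w ^ q)⁻¹) ^ (q + 1) = a := by
      rw [inv_pow, e4, mul_inv_cancel_right]
    rintro (h | h | h | h) <;> obtain ⟨rfl, rfl⟩ := Prod.mk.inj h
    · rfl
    · simp only [parityPoly, e4, hWq]
    · simp only [parityPoly, e1, e3, hWq, mul_comm (minpoly F ((a : Eˣ) : E))]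
    · simp only [parityPoly, e2, e5, mul_comm (minpoly F ((a : Eˣ) : E))]

variable (E) in
/-- Pairs `(a, w)` of units of `E` with `a ^ (q - 1) = 1` and `w` of order `q ^ 2 - 1`. -/
noncomputable def parityPairs [DecidableEq E] (q : ℕ) : Finset (Eˣ × Eˣ) :=
  (Finset.univ.filter fun a : Eˣ => a ^ (q - 1) = 1) ×ˢ
    (Finset.univ.filter fun w : Eˣ => orderOf w = q ^ 2 - 1)

lemma mem_parityPairs [DecidableEq E] {a w : Eˣ} :
    (a, w) ∈ parityPairs E q ↔ a ^ (q - 1) = 1 ∧ orderOf w = q ^ 2 - 1 := by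
  simp [parityPairs]

lemma sq_sub_one_eq (q : ℕ) : q ^ 2 - 1 = (q + 1) * (q - 1) := by
  simpa using Nat.sq_sub_sq q 1

lemma card_parityPairs [DecidableEq E] (hE : Fintype.card E = q ^ 2) :
    (parityPairs E q).card = (q - 1) * (q ^ 2 - 1).totient := by
  have hu : Fintype.card Eˣ = q ^ 2 - 1 := by rw [Fintype.card_units, hE]
  rw [parityPairs, Finset.card_product, IsCyclic.card_filter_pow_eq_one,
    IsCyclic.card_orderOf_eq_totient (hu ▸ dvd_rfl), Nat.card_eq_fintype_card, hu, sq_sub_one_eq,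
    Nat.gcd_mul_left_left]

lemma card_fiber_parityPoly [DecidableEq E] [DecidableEq F] (hq : 2 < q) (hF : Fintype.card F = q)
    (hE : Fintype.card E = q ^ 2) {p : Eˣ × Eˣ} (hp : p ∈ parityPairs E q) :
    ((parityPairs E q).filter fun p' => parityPoly F q p' = parityPoly F q p).card = 4 := by
  obtain ⟨a, w⟩ := p
  obtain ⟨ha1, hw⟩ := mem_parityPairs.1 hp
  have ha := pow_eq_self_of_pow_pred_eq_one hq ha1
  have hwq := orderOf_pow_self_eq hq hw
  have hww := pow_pow_eq_self_of_orderOf_eq hq hw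
  have hN1 : (a * w ^ (q + 1)) ^ (q - 1) = 1 := by
    rw [mul_pow, ha1, one_mul, ← pow_mul, ← sq_sub_one_eq, ← hw, pow_orderOf_eq_one]
  have hset : ((parityPairs E q).filter fun p' => parityPoly F q p' = parityPoly F q (a, w)) =
      {(a, w), (a, w ^ q), (a * w ^ (q + 1), w⁻¹), (a * w ^ (q + 1), (w ^ q)⁻¹)} := by
    ext ⟨a', w'⟩
    simp only [Finset.mem_filter, Finset.mem_insert, Finset.mem_singleton]
    constructor
    · rintro ⟨h, hP⟩
      obtain ⟨ha', hw'⟩ := mem_parityPairs.1 h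
      exact (parityPoly_eq_iff hq hF hE ha hw (pow_eq_self_of_pow_pred_eq_one hq ha') hw').1 hP
    · intro h
      have hmem : a' ^ (q - 1) = 1 ∧ orderOf w' = q ^ 2 - 1 := by
        rcases h with h | h | h | h <;> obtain ⟨rfl, rfl⟩ := Prod.mk.inj h
        · exact ⟨ha1, hw⟩
        · exact ⟨ha1, hwq⟩
        · exact ⟨hN1, by rw [orderOf_inv, hw]⟩
        · exact ⟨hN1, by rw [orderOf_inv, hwq]⟩
      exact ⟨mem_parityPairs.2 hmem, (parityPoly_eq_iff hq hF hE ha hw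
        (pow_eq_self_of_pow_pred_eq_one hq hmem.1) hmem.2).2 h⟩
  have h1 : w ≠ w ^ q := by
    simpa [eq_comm] using mul_pow_ne_self hq (one_pow q) hw
  have h2 : w ^ (q + 1) ≠ 1 := pow_ne_one_of_orderOf_eq hq hw (by omega) le_rfl
  rw [hset, Finset.card_insert_of_notMem, Finset.card_insert_of_notMem, Finset.card_pair]
  · simpa using h1
  · simp [h2]
  · simp [h1, h2]

lemma card_image_parityPoly [DecidableEq E] [DecidableEq F] (hq : 2 < q)
    (hF : Fintype.card F = q) (hE : Fintype.card E = q ^ 2) :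
    ((parityPairs E q).image (parityPoly F q)).card * 4 = (q - 1) * (q ^ 2 - 1).totient := by
  rw [← card_parityPairs hE, Finset.card_eq_sum_card_image (parityPoly F q), Finset.sum_const_nat]
  intro P hP
  obtain ⟨p, hp, rfl⟩ := Finset.mem_image.1 hP
  exact card_fiber_parityPoly hq hF hE hp

end Fields

section Exponents

variable {q e₁ e₂ e₃ k : ℤ}

lemma isCoprime_add_mul_iff_and (h₁ : k = e₃ - (q + 1) * e₁) (h₂ : q - 1 ∣ e₃ - (e₁ + e₂)) :
    IsCoprime k ((q + 1) * (q - 1)) ↔ IsCoprime (q + 1) e₃ ∧ IsCoprime (q - 1) (e₂ - e₁) := by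
  obtain ⟨c, hc⟩ := h₂
  have h3 : k = e₃ + (q + 1) * (-e₁) := by rw [h₁]; ring
  have h4 : k = (e₂ - e₁) + (q - 1) * (c - e₁) := by linear_combination h₁ + hc
  rw [IsCoprime.mul_right_iff]
  refine and_congr ?_ ?_
  · rw [h3, IsCoprime.add_mul_left_left_iff, isCoprime_comm]
  · rw [h4, IsCoprime.add_mul_left_left_iff, isCoprime_comm]

end Exponents

/-- For `q > 2`, the number of distinct cyclic codes `C_{((q+1)e₁,(q+1)e₂,e₃)}` (counted via
their parity-check polynomials `h_{(q+1)e₁}(x)h_{(q+1)e₂}(x)h_{e₃}(x)`, where `h_a` is the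
minimal polynomial of `γ^{-a}` over `F_q`) satisfying `gcd(q+1,e₃) = 1`,
`gcd(q-1,e₂-e₁) = 1`, and `e₃ ≡ e₁+e₂ (mod q-1)` is `(q-1)·φ(q²-1)/4`. -/
theorem count_five_weight_codes (q : ℕ) (hq : 2 < q)
    (hppow : ∃ (p n : ℕ), p.Prime ∧ 0 < n ∧ q = p ^ n)
    (F E : Type) [Field F] [Fintype F] [DecidableEq F] [Field E] [Fintype E] [DecidableEq E]
    [Algebra F E] (hF : Fintype.card F = q) (hE : Fintype.card E = q ^ 2)
    (γ : E) (hγ : ∀ x : E, x ≠ 0 → ∃ n : ℕ, γ ^ n = x) :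
    Set.ncard {P : Polynomial F | ∃ e₁ e₂ e₃ : ℤ,
        Int.gcd (q + 1) e₃ = 1 ∧ Int.gcd (q - 1) (e₂ - e₁) = 1 ∧
        ((q : ℤ) - 1) ∣ (e₃ - (e₁ + e₂)) ∧
        P = minpoly F (γ ^ (-(((q : ℤ) + 1) * e₁))) *
              minpoly F (γ ^ (-(((q : ℤ) + 1) * e₂))) *
              minpoly F (γ ^ (-e₃))} * 4 =
      (q - 1) * Nat.totient (q ^ 2 - 1) := by
  classical
  have hγ0 : γ ≠ 0 := by
    rintro rfl
    have hcard : 1 < Fintype.card Eˣ := by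
      rw [Fintype.card_units, hE]
      have : 2 < q ^ 2 := by nlinarith
      omega
    obtain ⟨x, hx⟩ := Fintype.exists_ne_of_one_lt_card hcard 1
    obtain ⟨n, hn⟩ := hγ x x.ne_zero
    rcases Nat.eq_zero_or_pos n with rfl | hpos
    · exact hx (Units.ext (by simpa using hn.symm))
    · exact x.ne_zero (by rw [← hn, zero_pow hpos.ne'])
  obtain ⟨g, rfl⟩ : ∃ g : Eˣ, (g : E) = γ := ⟨Units.mk0 γ hγ0, rfl⟩
  have hg : ∀ x : Eˣ, x ∈ Subgroup.zpowers g := fun x => by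
    obtain ⟨n, hn⟩ := hγ x x.ne_zero
    exact ⟨n, Units.ext (by simpa using hn)⟩
  have hord : orderOf g = q ^ 2 - 1 := by
    rw [orderOf_eq_card_of_forall_mem_zpowers hg, Nat.card_eq_fintype_card, Fintype.card_units, hE]
  have hcast : ((q ^ 2 - 1 : ℕ) : ℤ) = ((q : ℤ) + 1) * ((q : ℤ) - 1) := by
    rw [sq_sub_one_eq, Nat.cast_mul, Nat.cast_sub (by omega)]
    push_cast
    ring
  rw [← card_image_parityPoly hq hF hE (F := F), ← Set.ncard_coe_finset]
  congr 2
  ext P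
  simp only [Set.mem_ofPred_eq, Finset.coe_image, Set.mem_image, Finset.mem_coe,
    ← Int.isCoprime_iff_gcd_eq_one, ← Units.val_zpow_eq_zpow_val]
  constructor
  · rintro ⟨e₁, e₂, e₃, h₁, h₂, h₃, rfl⟩
    have hk := (isCoprime_add_mul_iff_and (e₁ := e₁) rfl h₃).2 ⟨h₁, h₂⟩
    refine ⟨(g ^ (-(((q : ℤ) + 1) * e₁)), g ^ (-(e₃ - ((q : ℤ) + 1) * e₁))),
      mem_parityPairs.2 ⟨?_, ?_⟩, ?_⟩
    · rw [← zpow_natCast, ← zpow_mul, ← orderOf_dvd_iff_zpow_eq_one, hord, hcast,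
        Nat.cast_sub (by omega)]
      exact ⟨-e₁, by push_cast; ring⟩
    · rw [← hord, orderOf_zpow_eq_orderOf_iff, hord, hcast]
      exact hk.neg_left
    · obtain ⟨c, hc⟩ := h₃
      have h3 : g ^ (-(((q : ℤ) + 1) * e₁)) * g ^ (-(e₃ - ((q : ℤ) + 1) * e₁)) = g ^ (-e₃) := by
        rw [← zpow_add]
        ring_nf
      have h2 : g ^ (-(((q : ℤ) + 1) * e₁)) * (g ^ (-(e₃ - ((q : ℤ) + 1) * e₁))) ^ (q + 1) =
          g ^ (-(((q : ℤ) + 1) * e₂)) := by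
        rw [← zpow_natCast, ← zpow_mul, ← zpow_add, ← orderOf_dvd_sub_iff_zpow_eq_zpow, hord, hcast]
        refine ⟨e₁ - c, ?_⟩
        push_cast
        linear_combination (-(q : ℤ) - 1) * hc
      simp only [parityPoly, h2, h3]
  · rintro ⟨⟨a, w⟩, hp, rfl⟩
    obtain ⟨ha, hw⟩ := mem_parityPairs.1 hp
    obtain ⟨n, rfl⟩ := hg a
    obtain ⟨k, rfl⟩ := hg w
    simp only at ha hw
    rw [← zpow_natCast, ← zpow_mul, ← orderOf_dvd_iff_zpow_eq_one, hord, hcast,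
      Nat.cast_sub (by omega), Nat.cast_one] at ha
    obtain ⟨m, rfl⟩ := Int.dvd_of_mul_dvd_mul_right (by omega) ha
    rw [← hord, orderOf_zpow_eq_orderOf_iff, hord, hcast] at hw
    have h₃ : (q : ℤ) - 1 ∣ (-k + (q + 1) * -m) - (-m + (-k + -m)) := ⟨-m, by ring⟩
    obtain ⟨h₁, h₂⟩ := (isCoprime_add_mul_iff_and (e₁ := -m) (k := -k) (by ring) h₃).1 hw.neg_left
    refine ⟨-m, -k + -m, -k + (q + 1) * -m, h₁, h₂, h₃, ?_⟩
    have h3 : g ^ (((q : ℤ) + 1) * m) * g ^ k = g ^ (-(-k + ((q : ℤ) + 1) * -m)) := by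
      rw [← zpow_add]
      ring_nf
    have h2 : g ^ (((q : ℤ) + 1) * m) * (g ^ k) ^ (q + 1) =
        g ^ (-(((q : ℤ) + 1) * (-k + -m))) := by
      rw [← zpow_natCast, ← zpow_mul, ← zpow_add]
      push_cast
      ring_nf
    have h1 : -(((q : ℤ) + 1) * -m) = (q + 1) * m := by ring
    simp only [parityPoly, h1, h2, h3]
end

section
/- Let q be a prime power, γ a primitive element of F_{q^2}, e_2, e_3 integers with gcd(e_3, q^2-1) = 1 and e_3 ≡ e_2 (mod q-1). Order F_q as u_0 = 0 and u_l = γ^{(q+1)(l-1)} for l = 1,…,q-1. Then the complete weight enumerator of the code C = { (b γ^{(q+1)i e_2} + Tr_{F_{q^2}/F_q}(c γ^{i e_3}))_{i=0}^{q^2-2} : b ∈ F_q, c ∈ F_{q^2} } equals z_0^{q^2-1} + (q-1)∏_{i=1}^{q-1} z_i^{q+1} + (q^2-1) z_0^{q-1} ∏_{i=1}^{q-1} z_i^{q} + (q^2-1) Σ_{j=1}^{q-1} z_0^{q} z_j ∏_{i=1, i≠j}^{q-1} z_i^{q+1}. -/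
/-- The codeword of `C_{((q+1)e₂,e₃)}` associated with `(b,c) ∈ F_q × F_{q²}`:
`(b·γ^{(q+1)ie₂} + Tr_{E/F}(c·γ^{ie₃}))_{i=0}^{q²-2}`, where `Tr_{E/F}(x) = x + x^q`. -/
def codeword3 (q : ℕ) (F E : Type) [Field F] [Field E] [Algebra F E]
    (γ : E) (e₂ e₃ : ℤ) (b : F) (c : E) : Fin (q ^ 2 - 1) → E := fun i =>
  algebraMap F E b * γ ^ (((q : ℤ) + 1) * i * e₂) +
    (c * γ ^ ((i : ℤ) * e₃) + (c * γ ^ ((i : ℤ) * e₃)) ^ q)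

/-- The value `b·N(x) + Tr(c·x)`, whose range over `x ≠ 0` gives the entries of a codeword. -/
noncomputable def normTraceForm {F E : Type} [Field F] [Field E] [Algebra F E]
    (b : F) (c x : E) : F :=
  b * Algebra.norm F x + Algebra.trace F E (c * x)

namespace normTraceForm

open Finset

section Algebraic

variable {F E : Type} [Field F] [Field E] [Algebra F E]

lemma map_zero_right [FiniteDimensional F E] (b : F) (c : E) : normTraceForm b c 0 = 0 := by
  simp [normTraceForm]

lemma map_sub_sub (b b' : F) (c c' x : E) :
    normTraceForm (b - b') (c - c') x = normTraceForm b c x - normTraceForm b' c' x := by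
  simp only [normTraceForm, sub_mul, map_sub]
  ring

lemma card_fiber_erase_zero [FiniteDimensional F E] [Fintype E] [DecidableEq F] [DecidableEq E]
    (b : F) (c : E) (u : F) :
    #{x ∈ univ.erase (0 : E) | normTraceForm b c x = u} =
      #{x : E | normTraceForm b c x = u} - if u = 0 then 1 else 0 := by
  rw [filter_erase]
  split_ifs with hu
  · exact card_erase_of_mem (by simp [map_zero_right, hu])
  · rw [erase_eq_of_notMem (by simpa [map_zero_right] using Ne.symm hu), Nat.sub_zero]

end Algebraic

lemma pow_card_card {F E : Type} [Fintype F] [Field E] [Fintype E]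
    (h : Fintype.card E = Fintype.card F ^ 2) (x : E) :
    (x ^ Fintype.card F) ^ Fintype.card F = x := by
  rw [← pow_mul, ← sq, ← h, FiniteField.pow_card]

lemma add_pow_card {F E : Type} [Field F] [Fintype F] [Field E] [Algebra F E] (x y : E) :
    (x + y) ^ Fintype.card F = x ^ Fintype.card F + y ^ Fintype.card F := by
  have := map_add (FiniteField.frobeniusAlgHom F E) x y
  simpa using this

section Quadratic

variable {F E : Type} [Field F] [Fintype F] [Field E] [Fintype E] [Algebra F E]

lemma finrank_eq_two (h : Fintype.card E = Fintype.card F ^ 2) : Module.finrank F E = 2 :=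
  Nat.pow_right_injective (Fintype.one_lt_card (α := F))
    ((Module.card_eq_pow_finrank (K := F) (V := E)).symm.trans h)

lemma algebraMap_norm_eq (h : Fintype.card E = Fintype.card F ^ 2) (x : E) :
    algebraMap F E (Algebra.norm F x) = x * x ^ Fintype.card F := by
  simp [FiniteField.algebraMap_norm_eq_prod_pow, finrank_eq_two h, prod_range_succ]

lemma algebraMap_trace_eq (h : Fintype.card E = Fintype.card F ^ 2) (x : E) :
    algebraMap F E (Algebra.trace F E x) = x + x ^ Fintype.card F := by
  simp [FiniteField.algebraMap_trace_eq_sum_pow, finrank_eq_two h, sum_range_succ]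

/-- Completing the norm: the form is a translate of `b·N` up to an additive constant. -/
lemma mul_norm_add (h : Fintype.card E = Fintype.card F ^ 2) {b : F} (hb : b ≠ 0) (c x : E) :
    b * Algebra.norm F (x + c ^ Fintype.card F / algebraMap F E b) =
      normTraceForm b c x + Algebra.norm F c / b := by
  apply (algebraMap F E).injective
  have hb' : algebraMap F E b ≠ 0 := by simpa
  have hbq : algebraMap F E b ^ Fintype.card F = algebraMap F E b := by
    rw [← map_pow, FiniteField.pow_card]
  simp only [normTraceForm, map_add, map_mul, map_div₀, algebraMap_norm_eq h,
    algebraMap_trace_eq h, add_pow_card, div_pow, hbq, pow_card_card h, mul_pow]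
  field_simp
  ring

lemma eq_zero_of_forall (h : Fintype.card E = Fintype.card F ^ 2) {b : F} {c : E}
    (hbc : ∀ x, normTraceForm b c x = 0) : b = 0 ∧ c = 0 := by
  have hb : b = 0 := by
    by_contra hb
    have h0 := mul_norm_add h hb c (-(c ^ Fintype.card F / algebraMap F E b))
    rw [hbc, neg_add_cancel, Algebra.norm_zero, mul_zero, zero_add, eq_comm,
      div_eq_zero_iff, or_iff_left hb, Algebra.norm_eq_zero_iff] at h0
    have h1 := hbc 1
    simp [normTraceForm, h0, hb] at h1
  refine ⟨hb, ?_⟩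
  by_contra hc
  obtain ⟨y, hy⟩ := Algebra.trace_surjective F E 1
  have h1 := hbc (c⁻¹ * y)
  simp [normTraceForm, hb, hc, hy] at h1

variable [DecidableEq F]

lemma card_trace_fiber (h : Fintype.card E = Fintype.card F ^ 2) (u : F) :
    #{x : E | Algebra.trace F E x = u} = Fintype.card F := by
  have hu (v : F) : #{x : E | Algebra.trace F E x = v} = #{x : E | Algebra.trace F E x = u} :=
    AddMonoidHom.card_fiber_eq_of_mem_range (Algebra.trace F E)
      (Algebra.trace_surjective F E v) (Algebra.trace_surjective F E u)
  have key := card_eq_sum_card_fiberwise (s := (univ : Finset E)) (t := (univ : Finset F))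
    (f := Algebra.trace F E) (fun _ _ ↦ by simp)
  simp only [hu, sum_const, card_univ, smul_eq_mul, h, sq] at key
  exact (Nat.eq_of_mul_eq_mul_left Fintype.card_pos key).symm

lemma card_norm_fiber (h : Fintype.card E = Fintype.card F ^ 2) (u : F) :
    #{x : E | Algebra.norm F x = u} = if u = 0 then 1 else Fintype.card F + 1 := by
  classical
  have h0 : #{x : E | Algebra.norm F x = 0} = 1 := by
    simp [Algebra.norm_eq_zero_iff, card_eq_one, Finset.ext_iff]
  split_ifs with hu0
  · rw [hu0, h0]
  have hu (v : F) (hv : v ≠ 0) :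
      #{x : E | Algebra.norm F x = v} = #{x : E | Algebra.norm F x = u} := by
    obtain ⟨y, hy⟩ := FiniteField.norm_surjective F E (v / u)
    have hy0 : y ≠ 0 := by
      rintro rfl
      rw [Algebra.norm_zero] at hy
      exact div_ne_zero hv hu0 hy.symm
    symm
    apply card_bij (fun x _ ↦ y * x)
    · intro x hx
      simp_all
    · intro x _ x' _ hxx
      exact mul_left_cancel₀ hy0 hxx
    · intro x hx
      refine ⟨y⁻¹ * x, ?_, by simp [hy0]⟩
      simp only [mem_filter, mem_univ, true_and] at hx ⊢
      have : Algebra.norm F y * Algebra.norm F (y⁻¹ * x) = Algebra.norm F x := by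
        rw [← map_mul]; simp [hy0]
      rw [hy, hx] at this
      exact mul_left_cancel₀ (div_ne_zero hv hu0) (this.trans (div_mul_cancel₀ v hu0).symm)
  have key := card_eq_sum_card_fiberwise (s := (univ : Finset E)) (t := (univ : Finset F))
    (f := Algebra.norm F) (fun _ _ ↦ by simp)
  rw [← add_sum_erase _ _ (mem_univ (0 : F)), h0,
    sum_congr rfl fun v hv ↦ hu v (ne_of_mem_erase hv), sum_const,
    card_erase_of_mem (mem_univ _), card_univ, card_univ, h, smul_eq_mul] at key
  obtain ⟨m, hm⟩ : ∃ m, Fintype.card F = m + 2 :=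
    ⟨_, (Nat.sub_add_cancel (Fintype.one_lt_card (α := F))).symm⟩
  rw [hm] at key ⊢
  simp only [Nat.add_succ_sub_one] at key
  apply Nat.eq_of_mul_eq_mul_left (Nat.succ_pos m)
  linarith

lemma card_fiber_of_right_eq_zero (h : Fintype.card E = Fintype.card F ^ 2) {b : F}
    (hb : b ≠ 0) (u : F) :
    #{x : E | normTraceForm b 0 x = u} = if u = 0 then 1 else Fintype.card F + 1 := by
  have := card_norm_fiber h (u / b)
  simpa [normTraceForm, eq_div_iff hb, mul_comm b, hb] using this

lemma card_fiber_of_left_eq_zero (h : Fintype.card E = Fintype.card F ^ 2) {c : E}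
    (hc : c ≠ 0) (u : F) : #{x : E | normTraceForm 0 c x = u} = Fintype.card F := by
  rw [← card_trace_fiber h u]
  apply card_equiv (Equiv.mulLeft₀ c hc)
  simp [normTraceForm]

lemma card_fiber_of_ne_zero (h : Fintype.card E = Fintype.card F ^ 2) {b : F} (hb : b ≠ 0)
    (c : E) (u : F) :
    #{x : E | normTraceForm b c x = u} =
      if u = -(Algebra.norm F c / b) then 1 else Fintype.card F + 1 := by
  have := card_fiber_of_right_eq_zero h hb (u + Algebra.norm F c / b)
  simp only [← add_eq_zero_iff_eq_neg]
  rw [← this]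
  apply card_equiv (Equiv.addRight (c ^ Fintype.card F / algebraMap F E b))
  intro x
  have := mul_norm_add h hb c x
  simp only [mem_filter, mem_univ, true_and, Equiv.coe_addRight]
  rw [show normTraceForm b 0 (x + c ^ Fintype.card F / algebraMap F E b) = _ by
    rw [normTraceForm, zero_mul, map_zero, add_zero, this], add_left_inj]

end Quadratic

section Enumerator

variable {F E : Type} [Field F] [Fintype F] [DecidableEq F] [Field E] [Fintype E]
  [DecidableEq E] [Algebra F E]

/-- The monomial recording how often each value is taken on nonzero arguments. -/
noncomputable def weightMonomial (b : F) (c : E) : MvPolynomial F ℤ :=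
  ∏ u : F, MvPolynomial.X u ^ #{x ∈ univ.erase (0 : E) | normTraceForm b c x = u}

lemma weightMonomial_zero_zero :
    weightMonomial (0 : F) (0 : E) = MvPolynomial.X 0 ^ (Fintype.card E - 1) := by
  rw [weightMonomial, ← mul_prod_erase _ _ (mem_univ (0 : F)), prod_eq_one, mul_one]
  · simp [normTraceForm, card_erase_of_mem]
  · intro u hu
    simp [normTraceForm, (ne_of_mem_erase hu).symm]

lemma weightMonomial_of_right_eq_zero (h : Fintype.card E = Fintype.card F ^ 2) {b : F}
    (hb : b ≠ 0) :
    weightMonomial b (0 : E) =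
      ∏ u ∈ univ.erase (0 : F), MvPolynomial.X u ^ (Fintype.card F + 1) := by
  rw [weightMonomial, ← mul_prod_erase _ _ (mem_univ (0 : F))]
  simp only [card_fiber_erase_zero, card_fiber_of_right_eq_zero h hb, if_true, Nat.sub_self,
    pow_zero, one_mul]
  exact prod_congr rfl fun u hu ↦ by simp [ne_of_mem_erase hu]

lemma weightMonomial_of_left_eq_zero (h : Fintype.card E = Fintype.card F ^ 2) {c : E}
    (hc : c ≠ 0) :
    weightMonomial (0 : F) c = MvPolynomial.X 0 ^ (Fintype.card F - 1) *
      ∏ u ∈ univ.erase (0 : F), MvPolynomial.X u ^ Fintype.card F := by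
  rw [weightMonomial, ← mul_prod_erase _ _ (mem_univ (0 : F))]
  simp only [card_fiber_erase_zero, card_fiber_of_left_eq_zero h hc, if_true]
  congr 1
  exact prod_congr rfl fun u hu ↦ by simp [ne_of_mem_erase hu]

lemma weightMonomial_of_ne_zero (h : Fintype.card E = Fintype.card F ^ 2) {b : F} (hb : b ≠ 0)
    {c : E} (hc : c ≠ 0) {w : F} (hw : w = -(Algebra.norm F c / b)) :
    weightMonomial b c = MvPolynomial.X 0 ^ Fintype.card F * MvPolynomial.X w *
      ∏ u ∈ (univ.erase (0 : F)).erase w, MvPolynomial.X u ^ (Fintype.card F + 1) := by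
  have hw0 : w ≠ 0 := by simp [hw, hb, hc]
  rw [weightMonomial, ← mul_prod_erase _ _ (mem_univ (0 : F)),
    ← mul_prod_erase _ _ (mem_erase.2 ⟨hw0, mem_univ w⟩), mul_assoc]
  simp only [card_fiber_erase_zero, card_fiber_of_ne_zero h hb, ← hw, hw0, hw0.symm, if_true,
    if_false, Nat.add_sub_cancel, Nat.sub_zero, pow_one]
  congr 2
  refine prod_congr rfl fun u hu ↦ ?_
  simp only [mem_erase] at hu
  simp [hu.1, hu.2.1]

lemma sum_weightMonomial_of_ne_zero (h : Fintype.card E = Fintype.card F ^ 2) {c : E}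
    (hc : c ≠ 0) :
    ∑ b ∈ univ.erase (0 : F), weightMonomial b c =
      ∑ w ∈ univ.erase (0 : F), MvPolynomial.X 0 ^ Fintype.card F * MvPolynomial.X w *
        ∏ u ∈ (univ.erase (0 : F)).erase w, MvPolynomial.X u ^ (Fintype.card F + 1) := by
  have hn : Algebra.norm F c ≠ 0 := by simpa
  refine sum_nbij' (fun b ↦ -(Algebra.norm F c / b)) (fun b ↦ -(Algebra.norm F c / b))
    ?_ ?_ ?_ ?_ fun b hb ↦ weightMonomial_of_ne_zero h (ne_of_mem_erase hb) hc rfl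
  · intro b hb
    simp_all
  · intro b hb
    simp_all
  · intro b hb
    have := ne_of_mem_erase hb
    field_simp
  · intro b hb
    have := ne_of_mem_erase hb
    field_simp

lemma sum_weightMonomial (h : Fintype.card E = Fintype.card F ^ 2) :
    ∑ bc : F × E, weightMonomial bc.1 bc.2 =
      MvPolynomial.X (0 : F) ^ (Fintype.card F ^ 2 - 1) +
        MvPolynomial.C ((Fintype.card F : ℤ) - 1) *
          ∏ u ∈ univ.erase (0 : F), MvPolynomial.X u ^ (Fintype.card F + 1) +
        MvPolynomial.C ((Fintype.card F : ℤ) ^ 2 - 1) *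
          MvPolynomial.X (0 : F) ^ (Fintype.card F - 1) *
          ∏ u ∈ univ.erase (0 : F), MvPolynomial.X u ^ Fintype.card F +
        MvPolynomial.C ((Fintype.card F : ℤ) ^ 2 - 1) *
          ∑ w ∈ univ.erase (0 : F), MvPolynomial.X 0 ^ Fintype.card F * MvPolynomial.X w *
            ∏ u ∈ (univ.erase (0 : F)).erase w, MvPolynomial.X u ^ (Fintype.card F + 1) := by
  have hF : 1 ≤ Fintype.card F := Fintype.card_pos
  rw [Fintype.sum_prod_type_right, ← add_sum_erase _ _ (mem_univ (0 : E)),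
    ← add_sum_erase _ _ (mem_univ (0 : F)), weightMonomial_zero_zero,
    sum_congr rfl fun b hb ↦ weightMonomial_of_right_eq_zero h (ne_of_mem_erase hb),
    sum_congr rfl fun c hc ↦ (add_sum_erase _ _ (mem_univ (0 : F))).symm.trans
      (congrArg₂ (· + ·) (weightMonomial_of_left_eq_zero h (ne_of_mem_erase hc))
        (sum_weightMonomial_of_ne_zero h (ne_of_mem_erase hc)))]
  simp only [sum_const, card_erase_of_mem (mem_univ _), card_univ, h, nsmul_eq_mul]
  rw [Nat.cast_sub hF, Nat.cast_sub (Nat.one_le_pow _ _ hF)]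
  simp only [map_sub, map_pow, map_natCast, map_one, Nat.cast_pow, Nat.cast_one]
  ring

end Enumerator

lemma zpow_eq_one_iff_orderOf_dvd {E : Type} [Field E] {γ : E} (hγ0 : γ ≠ 0) (n : ℤ) :
    γ ^ n = 1 ↔ (orderOf γ : ℤ) ∣ n := by
  have := orderOf_dvd_iff_zpow_eq_one (x := Units.mk0 γ hγ0) (i := n)
  rw [← orderOf_units, Units.val_mk0] at this
  rw [this, Units.ext_iff]
  simp

section Primitive

variable {F E : Type} [Field E] [Fintype E] {γ : E}

lemma orderOf_eq_card_sub_one (hγ0 : γ ≠ 0) (hγ : ∀ x : E, x ≠ 0 → ∃ n : ℕ, γ ^ n = x) :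
    orderOf γ = Fintype.card E - 1 := by
  classical
  have hg : ∀ x : Eˣ, x ∈ Submonoid.powers (Units.mk0 γ hγ0) := by
    intro x
    obtain ⟨n, hn⟩ := hγ x x.ne_zero
    exact ⟨n, Units.ext (by simpa using hn)⟩
  have := orderOf_eq_card_of_forall_mem_powers hg
  rw [← orderOf_units, Nat.card_units, Nat.card_eq_fintype_card] at this
  simpa using this

variable [Fintype F]

lemma ne_zero_of_forall_pow [Field F] (h : Fintype.card E = Fintype.card F ^ 2)
    (hγ : ∀ x : E, x ≠ 0 → ∃ n : ℕ, γ ^ n = x) : γ ≠ 0 := by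
  classical
  rintro rfl
  have h2 : 2 < #(univ : Finset E) := by
    rw [card_univ, h]
    nlinarith [Fintype.one_lt_card (α := F)]
  obtain ⟨x, -, hx⟩ := exists_mem_notMem_of_card_lt_card
    (lt_of_le_of_lt (card_le_two (a := (0 : E)) (b := 1)) h2)
  simp only [mem_insert, mem_singleton, not_or] at hx
  obtain ⟨n, hn⟩ := hγ x hx.1
  rcases n.eq_zero_or_pos with rfl | hpos
  · exact hx.2 (by simpa using hn.symm)
  · exact hx.1 (by simpa [hpos.ne'] using hn.symm)

lemma zpow_mul_injective [Field F] (h : Fintype.card E = Fintype.card F ^ 2) (hγ0 : γ ≠ 0)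
    (hγ : ∀ x : E, x ≠ 0 → ∃ n : ℕ, γ ^ n = x) {e₃ : ℤ}
    (he₃ : Int.gcd (Fintype.card F ^ 2 - 1) e₃ = 1) :
    Function.Injective fun i : Fin (Fintype.card F ^ 2 - 1) ↦ γ ^ ((i : ℤ) * e₃) := by
  intro i j hij
  have hF : 1 ≤ Fintype.card F ^ 2 := Nat.one_le_pow _ _ Fintype.card_pos
  have h1 : γ ^ (((i : ℤ) - j) * e₃) = 1 := by
    rw [sub_mul, zpow_sub₀ hγ0]
    exact (div_eq_one_iff_eq (zpow_ne_zero _ hγ0)).2 hij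
  rw [zpow_eq_one_iff_orderOf_dvd hγ0, orderOf_eq_card_sub_one hγ0 hγ, h] at h1
  have hcast : ((Fintype.card F ^ 2 - 1 : ℕ) : ℤ) = (Fintype.card F : ℤ) ^ 2 - 1 := by
    push_cast [Nat.cast_sub hF]
    rfl
  have h2 : ((Fintype.card F ^ 2 - 1 : ℕ) : ℤ) ∣ (i : ℤ) - j :=
    Int.dvd_of_dvd_mul_left_of_gcd_one h1 (by rw [hcast]; exact he₃)
  have h3 := Int.eq_zero_of_abs_lt_dvd h2 (by rw [abs_lt]; omega)
  exact Fin.ext (by omega)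

lemma image_zpow_mul [Field F] [DecidableEq E] (h : Fintype.card E = Fintype.card F ^ 2)
    (hγ0 : γ ≠ 0)
    (hγ : ∀ x : E, x ≠ 0 → ∃ n : ℕ, γ ^ n = x) {e₃ : ℤ}
    (he₃ : Int.gcd (Fintype.card F ^ 2 - 1) e₃ = 1) :
    univ.image (fun i : Fin (Fintype.card F ^ 2 - 1) ↦ γ ^ ((i : ℤ) * e₃)) =
      univ.erase (0 : E) := by
  apply eq_of_subset_of_card_le
  · intro x hx
    obtain ⟨i, -, rfl⟩ := mem_image.1 hx
    simp [zpow_ne_zero _ hγ0]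
  · rw [card_image_of_injective _ (zpow_mul_injective h hγ0 hγ he₃),
      card_erase_of_mem (mem_univ _), card_univ, card_univ, h, Fintype.card_fin]

end Primitive

section Codeword

variable {F E : Type} [Field F] [Fintype F] [Field E] [Fintype E] [Algebra F E] {γ : E}

lemma codeword3_apply (h : Fintype.card E = Fintype.card F ^ 2) (hγ0 : γ ≠ 0) {e₂ e₃ : ℤ}
    (hcong : ((Fintype.card F : ℤ) - 1) ∣ e₃ - e₂) (b : F) (c : E)
    (i : Fin (Fintype.card F ^ 2 - 1)) :
    codeword3 (Fintype.card F) F E γ e₂ e₃ b c i =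
      algebraMap F E (normTraceForm b c (γ ^ ((i : ℤ) * e₃))) := by
  have hN : γ ^ (((Fintype.card F : ℤ) + 1) * i * e₂) =
      algebraMap F E (Algebra.norm F (γ ^ ((i : ℤ) * e₃))) := by
    obtain ⟨k, hk⟩ := hcong
    have h1 : γ ^ ((Fintype.card F : ℤ) ^ 2 - 1) = 1 := by
      rw [zpow_sub₀ hγ0, zpow_one]
      have : γ ^ ((Fintype.card F : ℤ) ^ 2) = γ := by
        exact_mod_cast (h ▸ FiniteField.pow_card γ : γ ^ Fintype.card F ^ 2 = γ)
      rw [this, div_self hγ0]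
    rw [algebraMap_norm_eq h, ← pow_succ', ← zpow_natCast, ← zpow_mul,
      show (i : ℤ) * e₃ * ((Fintype.card F + 1 : ℕ) : ℤ) =
        ((Fintype.card F : ℤ) + 1) * i * e₂ + ((Fintype.card F : ℤ) ^ 2 - 1) * (i * k) by
          push_cast
          linear_combination (i : ℤ) * ((Fintype.card F : ℤ) + 1) * hk,
      zpow_add₀ hγ0, zpow_mul γ ((Fintype.card F : ℤ) ^ 2 - 1), h1, one_zpow, mul_one]
  simp [codeword3, normTraceForm, hN, algebraMap_trace_eq h]

lemma codeword3_injective (h : Fintype.card E = Fintype.card F ^ 2) (hγ0 : γ ≠ 0)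
    (hγ : ∀ x : E, x ≠ 0 → ∃ n : ℕ, γ ^ n = x) {e₂ e₃ : ℤ}
    (he₃ : Int.gcd (Fintype.card F ^ 2 - 1) e₃ = 1)
    (hcong : ((Fintype.card F : ℤ) - 1) ∣ e₃ - e₂) :
    Function.Injective fun bc : F × E ↦
      codeword3 (Fintype.card F) F E γ e₂ e₃ bc.1 bc.2 := by
  classical
  rintro ⟨b, c⟩ ⟨b', c'⟩ hbc
  have key : ∀ x : E, normTraceForm (b - b') (c - c') x = 0 := by
    intro x
    by_cases hx : x = 0
    · rw [hx, map_zero_right]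
    · have hmem : x ∈ univ.erase (0 : E) := by simp [hx]
      rw [← image_zpow_mul h hγ0 hγ he₃] at hmem
      obtain ⟨i, -, rfl⟩ := mem_image.1 hmem
      have hi := congrFun hbc i
      simp only [codeword3_apply h hγ0 hcong] at hi
      rw [map_sub_sub, (algebraMap F E).injective hi, sub_self]
  obtain ⟨hb, hc⟩ := eq_zero_of_forall h key
  rw [sub_eq_zero.1 hb, sub_eq_zero.1 hc]

lemma card_codeword3_eq [DecidableEq F] [DecidableEq E]
    (h : Fintype.card E = Fintype.card F ^ 2) (hγ0 : γ ≠ 0)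
    (hγ : ∀ x : E, x ≠ 0 → ∃ n : ℕ, γ ^ n = x) {e₂ e₃ : ℤ}
    (he₃ : Int.gcd (Fintype.card F ^ 2 - 1) e₃ = 1)
    (hcong : ((Fintype.card F : ℤ) - 1) ∣ e₃ - e₂) (b : F) (c : E) (u : F) :
    #{i | codeword3 (Fintype.card F) F E γ e₂ e₃ b c i = algebraMap F E u} =
      #{x ∈ univ.erase (0 : E) | normTraceForm b c x = u} := by
  rw [← image_zpow_mul h hγ0 hγ he₃, filter_image,
    card_image_of_injective _ (zpow_mul_injective h hγ0 hγ he₃)]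
  simp only [codeword3_apply h hγ0 hcong, (algebraMap F E).injective.eq_iff]

end Codeword

end normTraceForm

/-- The complete weight enumerator of the three-weight code `C_{((q+1)e₂,e₃)}`, with
variables `z_u` indexed by the elements `u ∈ F_q`, equals
`z₀^{q²-1} + (q-1)·∏_{u≠0} z_u^{q+1} + (q²-1)·z₀^{q-1}·∏_{u≠0} z_u^{q}
 + (q²-1)·Σ_{w≠0} z₀^{q}·z_w·∏_{u≠0, u≠w} z_u^{q+1}`. -/
theorem complete_weight_enumerator (q : ℕ)
    (hppow : ∃ (p n : ℕ), p.Prime ∧ 0 < n ∧ q = p ^ n)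
    (F E : Type) [Field F] [Fintype F] [DecidableEq F] [Field E] [Fintype E] [DecidableEq E]
    [Algebra F E] (hF : Fintype.card F = q) (hE : Fintype.card E = q ^ 2)
    (γ : E) (hγ : ∀ x : E, x ≠ 0 → ∃ n : ℕ, γ ^ n = x)
    (e₂ e₃ : ℤ) (he₃ : Int.gcd (q ^ 2 - 1) e₃ = 1) (hcong : ((q : ℤ) - 1) ∣ (e₃ - e₂)) :
    ∑ v ∈ (Set.toFinite {v : Fin (q ^ 2 - 1) → E |
        ∃ (b : F) (c : E), v = codeword3 q F E γ e₂ e₃ b c}).toFinset,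
      ∏ u : F, (MvPolynomial.X u : MvPolynomial F ℤ) ^
        (Finset.univ.filter (fun i : Fin (q ^ 2 - 1) => v i = algebraMap F E u)).card =
      (MvPolynomial.X (0 : F)) ^ (q ^ 2 - 1) +
        MvPolynomial.C ((q : ℤ) - 1) *
          ∏ u ∈ Finset.univ.filter (fun u : F => u ≠ 0), MvPolynomial.X u ^ (q + 1) +
        MvPolynomial.C ((q : ℤ) ^ 2 - 1) * (MvPolynomial.X (0 : F)) ^ (q - 1) *
          ∏ u ∈ Finset.univ.filter (fun u : F => u ≠ 0), MvPolynomial.X u ^ q +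
        MvPolynomial.C ((q : ℤ) ^ 2 - 1) *
          ∑ w ∈ Finset.univ.filter (fun w : F => w ≠ 0),
            (MvPolynomial.X (0 : F)) ^ q * MvPolynomial.X w *
              ∏ u ∈ (Finset.univ.filter (fun u : F => u ≠ 0)).erase w,
                MvPolynomial.X u ^ (q + 1) := by
  subst hF
  have hγ0 := normTraceForm.ne_zero_of_forall_pow hE hγ
  have himage : (Set.toFinite {v : Fin (Fintype.card F ^ 2 - 1) → E |
      ∃ (b : F) (c : E), v = codeword3 (Fintype.card F) F E γ e₂ e₃ b c}).toFinset =
      Finset.univ.image fun bc : F × E ↦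
        codeword3 (Fintype.card F) F E γ e₂ e₃ bc.1 bc.2 := by
    ext v
    simp [eq_comm]
  rw [himage, Finset.sum_image
    (normTraceForm.codeword3_injective hE hγ0 hγ he₃ hcong).injOn]
  simp only [normTraceForm.card_codeword3_eq hE hγ0 hγ he₃ hcong, Finset.filter_ne']
  exact normTraceForm.sum_weightMonomial hE
end
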